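/- If 1 < p ≤ q < ∞ and Banach spaces E and F contain complemented subspaces isomorphic to ℓ_p and ℓ_q respectively, then L(E;F) does not have the approximation property. -/

import Mathlib

open scoped ENNReal

noncomputable section

/-- A normed space `E` has the approximation property if for every compact set `K` and `ε > 0`
there is a finite rank bounded operator `T : E → E` with `‖T x - x‖ < ε` on `K`. -/
def HasAP (𝕜 E : Type*) [NontriviallyNormedField 𝕜] [SeminormedAddCommGroup E]
    [NormedSpace 𝕜 E] : Prop :=
  ∀ K : Set E, IsCompact K → ∀ ε : ℝ, 0 < ε →
    ∃ T : E →L[𝕜] E, FiniteDimensional 𝕜 (LinearMap.range (T : E →ₗ[𝕜] E)) ∧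
      ∀ x ∈ K, ‖T x - x‖ < ε

set_option linter.all false

namespace SzAP

/-! ### signs -/
def sg (x : ZMod 2) : ℝ := if x = 0 then 1 else -1

lemma sg_zero : sg 0 = 1 := by simp [sg]
lemma sg_one : sg 1 = -1 := by simp [sg]
lemma zmod2_cases (x : ZMod 2) : x = 0 ∨ x = 1 := by revert x; decide
lemma sg_add (x y : ZMod 2) : sg (x + y) = sg x * sg y := by
  rcases zmod2_cases x with rfl | rfl <;> rcases zmod2_cases y with rfl | rfl <;>
    simp [sg, show (1:ZMod 2) + 1 = 0 from by decide]
lemma sg_mul_self (x : ZMod 2) : sg x * sg x = 1 := by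
  rcases zmod2_cases x with rfl | rfl <;> simp [sg]
lemma abs_sg (x : ZMod 2) : |sg x| = 1 := by
  rcases zmod2_cases x with rfl | rfl <;> simp [sg]

lemma add_self2 {L : Type*} [AddCommGroup L] [Module (ZMod 2) L] (v : L) : v + v = 0 := by
  have : ((1:ZMod 2) + 1) • v = 0 := by
    rw [show (1:ZMod 2) + 1 = 0 from by decide, zero_smul]
  simpa [add_smul] using this

section Fourier
variable {L : Type*} [AddCommGroup L] [Module (ZMod 2) L] [Finite L]

instance : Finite (Module.Dual (ZMod 2) L) := DFunLike.finite _

lemma card_dual : Nat.card (Module.Dual (ZMod 2) L) = Nat.card L := by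
  haveI : Module.Finite (ZMod 2) L := Module.Finite.of_finite
  rw [Module.natCard_eq_pow_finrank (K := ZMod 2) (V := L),
    Module.natCard_eq_pow_finrank (K := ZMod 2) (V := Module.Dual (ZMod 2) L),
    Subspace.dual_finrank_eq]

lemma sum_dual [Fintype L] [Fintype (Module.Dual (ZMod 2) L)] {v : L} (hv : v ≠ 0) :
    ∑ ξ : Module.Dual (ZMod 2) L, sg (ξ v) = 0 := by
  obtain ⟨η, hη⟩ : ∃ η : Module.Dual (ZMod 2) L, η v ≠ 0 := by
    by_contra! h
    exact hv ((Module.forall_dual_apply_eq_zero_iff (ZMod 2) v).1 h)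
  have h1 : η v = 1 := (zmod2_cases _).resolve_left hη
  have h := Equiv.sum_comp (Equiv.addRight η) (fun ξ : Module.Dual (ZMod 2) L => sg (ξ v))
  have : ∑ ξ : Module.Dual (ZMod 2) L, sg ((Equiv.addRight η ξ) v)
      = - ∑ ξ : Module.Dual (ZMod 2) L, sg (ξ v) := by
    rw [← Finset.sum_neg_distrib]
    refine Finset.sum_congr rfl fun ξ _ => ?_
    simp [sg_add, h1, sg_one]
  linarith

lemma sum_char [Fintype L] (ξ : L →+ ZMod 2) {w : L} (hw : ξ w = 1) :
    ∑ v : L, sg (ξ v) = 0 := by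
  have h := Equiv.sum_comp (Equiv.addRight w) (fun v : L => sg (ξ v))
  have : ∑ v : L, sg (ξ (Equiv.addRight w v)) = - ∑ v : L, sg (ξ v) := by
    rw [← Finset.sum_neg_distrib]
    refine Finset.sum_congr rfl fun ξ _ => ?_
    simp [sg_add, hw, sg_one]
  linarith
end Fourier

section Op
variable {𝕜 : Type*} [RCLike 𝕜] {H : Type*} [NormedAddCommGroup H] [InnerProductSpace 𝕜 H]
  {L : Type*} [AddCommGroup L] [Module (ZMod 2) L] [Fintype L]
  (U : L → H →L[𝕜] H)

def pr (ξ : Module.Dual (ZMod 2) L) : H →L[𝕜] H :=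
  ((Fintype.card L : 𝕜)⁻¹) • ∑ v : L, ((sg (ξ v) : ℝ) : 𝕜) • U v

variable (hU : ∀ v w, U (v + w) = U v * U w) (hU0 : U 0 = 1) (hn : ∀ v h, ‖U v h‖ = ‖h‖)

include hU in
lemma pr_mul (ξ : Module.Dual (ZMod 2) L) (w : L) :
    pr U ξ * U w = ((sg (ξ w) : ℝ) : 𝕜) • pr U ξ := by
  unfold pr
  rw [smul_mul_assoc, Finset.sum_mul, smul_comm]
  congr 1
  rw [Finset.smul_sum, ← Equiv.sum_comp (Equiv.addRight w)]
  refine Finset.sum_congr rfl fun v _ => ?_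
  simp only [Equiv.coe_addRight, map_add, sg_add]
  have : v + w + w = v := by rw [add_assoc, add_self2, add_zero]
  rw [smul_mul_assoc, ← hU, this, smul_smul, ← RCLike.ofReal_mul, mul_comm]

include hU in
lemma pr_mul_pr (ξ : Module.Dual (ZMod 2) L) : pr U ξ * pr U ξ = pr U ξ := by
  conv_lhs => rhs; unfold pr
  rw [mul_smul_comm, Finset.mul_sum]
  have : ∀ v : L, pr U ξ * (((sg (ξ v) : ℝ) : 𝕜) • U v) = pr U ξ := by
    intro v
    rw [mul_smul_comm, pr_mul U hU, smul_smul, ← RCLike.ofReal_mul, sg_mul_self]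
    simp
  simp only [this, Finset.sum_const, Finset.card_univ]
  rw [← Nat.cast_smul_eq_nsmul 𝕜, smul_smul, inv_mul_cancel₀, one_smul]
  exact_mod_cast Fintype.card_ne_zero

include hU0 in
lemma sum_pr [Fintype (Module.Dual (ZMod 2) L)] :
    ∑ ξ : Module.Dual (ZMod 2) L, pr U ξ = 1 := by
  unfold pr
  rw [← Finset.smul_sum, Finset.sum_comm, Finset.sum_eq_single (0 : L)]
  · simp only [map_zero, sg_zero, RCLike.ofReal_one, one_smul, hU0, Finset.sum_const,
      Finset.card_univ]
    have := card_dual (L := L)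
    simp only [Nat.card_eq_fintype_card] at this
    rw [this, ← Nat.cast_smul_eq_nsmul 𝕜, smul_smul, inv_mul_cancel₀, one_smul]
    exact_mod_cast Fintype.card_ne_zero
  · intro v _ hv
    rw [← Finset.sum_smul]
    have := sum_dual (L := L) hv
    rw [← RCLike.ofReal_sum, this]; simp
  · simp

include hU hU0 hn in
lemma U_symm (v : L) (x y : H) : inner 𝕜 (U v x) y = inner 𝕜 x (U v y) := by
  have h2 : U v (U v y) = y := by
    rw [← ContinuousLinearMap.mul_apply, ← hU, add_self2, hU0]; rfl
  let I : H →ₗᵢ[𝕜] H := ⟨(U v).toLinearMap, hn v⟩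
  have := I.inner_map_map x (U v y)
  change inner 𝕜 (U v x) (U v (U v y)) = _ at this
  rwa [h2] at this

include hU hU0 hn in
lemma pr_symm (ξ : Module.Dual (ZMod 2) L) (x y : H) :
    inner 𝕜 (pr U ξ x) y = inner 𝕜 x (pr U ξ y) := by
  simp only [pr, ContinuousLinearMap.smul_apply, ContinuousLinearMap.sum_apply,
    inner_smul_left, inner_smul_right, sum_inner, inner_sum, U_symm U hU hU0 hn]
  simp

include hU hU0 hn in
lemma sum_norm_pr [Fintype (Module.Dual (ZMod 2) L)] (h : H) :
    ∑ ξ : Module.Dual (ZMod 2) L, ‖pr U ξ h‖ ^ 2 = ‖h‖ ^ 2 := by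
  have : ∀ ξ, ‖pr U ξ h‖ ^ 2 = RCLike.re (inner 𝕜 h (pr U ξ h)) := by
    intro ξ
    rw [← inner_self_eq_norm_sq (𝕜 := 𝕜), pr_symm U hU hU0 hn, ← ContinuousLinearMap.mul_apply,
      pr_mul_pr U hU]
  simp only [this]
  rw [← map_sum, ← inner_sum, ← ContinuousLinearMap.sum_apply, sum_pr U hU0,
    ← inner_self_eq_norm_sq (𝕜 := 𝕜)]
  rfl

include hU hU0 hn in
lemma norm_comb_le {P : Type*} [Fintype P] (d : P → ℝ) (v : P → L) (ε : ℝ) (hε : 0 ≤ ε)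
    (hd : ∀ η : Module.Dual (ZMod 2) L, |∑ i, d i * sg (η (v i))| ≤ ε) :
    ‖∑ i, ((d i : ℝ) : 𝕜) • U (v i)‖ ≤ ε := by
  classical
  haveI := Fintype.ofFinite (Module.Dual (ZMod 2) L)
  refine ContinuousLinearMap.opNorm_le_bound _ hε fun h => ?_
  refine le_of_sq_le_sq ?_ (by positivity) |> fun h => h
  rw [← sum_norm_pr U hU hU0 hn, mul_pow, ← sum_norm_pr U hU hU0 hn h, Finset.mul_sum]
  refine Finset.sum_le_sum fun ξ _ => ?_
  have : pr U ξ * (∑ i, ((d i : ℝ) : 𝕜) • U (v i)) =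
      (((∑ i, d i * sg (ξ (v i)) : ℝ)) : 𝕜) • pr U ξ := by
    rw [Finset.mul_sum, RCLike.ofReal_sum, Finset.sum_smul]
    refine Finset.sum_congr rfl fun i _ => ?_
    rw [mul_smul_comm, pr_mul U hU, smul_smul, RCLike.ofReal_mul]
  rw [← ContinuousLinearMap.mul_apply, this, ContinuousLinearMap.smul_apply, norm_smul, mul_pow]
  gcongr
  rw [RCLike.norm_ofReal]
  exact hd ξ

include hU hU0 hn in
lemma norm_trace_le {ι : Type*} [Fintype ι] [DecidableEq ι] (b : OrthonormalBasis ι 𝕜 H)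
    (ξ : Module.Dual (ZMod 2) L) (Y : H →L[𝕜] H) (C : ℝ) (hY : ‖Y‖ ≤ C) :
    ‖LinearMap.trace 𝕜 H ((pr U ξ * Y : H →L[𝕜] H) : H →ₗ[𝕜] H)‖ ≤
      C * ∑ i, ‖pr U ξ (b i)‖ ^ 2 := by
  have h1 : LinearMap.trace 𝕜 H ((pr U ξ * Y : H →L[𝕜] H) : H →ₗ[𝕜] H) =
      LinearMap.trace 𝕜 H ((pr U ξ * Y * pr U ξ : H →L[𝕜] H) : H →ₗ[𝕜] H) := by
    conv_lhs => rw [← pr_mul_pr U hU ξ, mul_assoc]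
    exact LinearMap.trace_mul_comm 𝕜 (pr U ξ : H →ₗ[𝕜] H) ((pr U ξ * Y : H →L[𝕜] H) : H →ₗ[𝕜] H)
  rw [h1, LinearMap.trace_eq_sum_inner _ b, Finset.mul_sum]
  refine (norm_sum_le _ _).trans (Finset.sum_le_sum fun i _ => ?_)
  have : inner 𝕜 (b i) (((pr U ξ * Y * pr U ξ : H →L[𝕜] H) : H →ₗ[𝕜] H) (b i)) =
      inner 𝕜 (pr U ξ (b i)) (Y (pr U ξ (b i))) := by
    rw [pr_symm U hU hU0 hn]; rfl
  rw [this]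
  calc _ ≤ ‖pr U ξ (b i)‖ * ‖Y (pr U ξ (b i))‖ := norm_inner_le_norm _ _
    _ ≤ ‖pr U ξ (b i)‖ * (C * ‖pr U ξ (b i)‖) := by
        gcongr
        exact (Y.le_opNorm _).trans (by gcongr)
    _ = _ := by ring

/-- The key estimate. -/
lemma key_op {ι : Type*} [Fintype ι] [DecidableEq ι] (b : OrthonormalBasis ι 𝕜 H)
    (hU : ∀ v w, U (v + w) = U v * U w) (hU0 : U 0 = 1) (hn : ∀ v h, ‖U v h‖ = ‖h‖)
    [Fintype (Module.Dual (ZMod 2) L)]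
    (Y : Module.Dual (ZMod 2) L → H →L[𝕜] H) (C : ℝ) (hY : ∀ ξ, ‖Y ξ‖ ≤ C) :
    ‖∑ ξ, LinearMap.trace 𝕜 H ((pr U ξ * Y ξ : H →L[𝕜] H) : H →ₗ[𝕜] H)‖ ≤
      Fintype.card ι * C := by
  calc _ ≤ ∑ ξ, C * ∑ i, ‖pr U ξ (b i)‖ ^ 2 :=
        (norm_sum_le _ _).trans (Finset.sum_le_sum fun ξ _ =>
          norm_trace_le U hU hU0 hn b ξ (Y ξ) C (hY ξ))
    _ = C * ∑ i, ∑ ξ, ‖pr U ξ (b i)‖ ^ 2 := by rw [← Finset.mul_sum, Finset.sum_comm]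
    _ = _ := by simp [sum_norm_pr U hU hU0 hn, mul_comm]

lemma U_eq_sum [Fintype (Module.Dual (ZMod 2) L)] (hU : ∀ v w, U (v + w) = U v * U w)
    (hU0 : U 0 = 1) (v : L) :
    U v = ∑ ξ : Module.Dual (ZMod 2) L, ((sg (ξ v) : ℝ) : 𝕜) • pr U ξ := by
  have : U v = (∑ ξ : Module.Dual (ZMod 2) L, pr U ξ) * U v := by rw [sum_pr U hU0, one_mul]
  rw [this, Finset.sum_mul]
  exact Finset.sum_congr rfl fun ξ _ => pr_mul U hU ξ v
end Op

/-! ### regular representation -/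
section Reg
variable (𝕜 : Type*) [RCLike 𝕜] {G : Type} [Group G] [Fintype G]

abbrev Hs (G : Type) [Fintype G] := EuclideanSpace 𝕜 G
abbrev Ms (G : Type) [Fintype G] := Hs 𝕜 G →L[𝕜] Hs 𝕜 G

def reg (g : G) : Ms 𝕜 G :=
  (LinearIsometryEquiv.piLpCongrLeft 2 𝕜 𝕜 (Equiv.mulLeft g)).toContinuousLinearEquiv.toContinuousLinearMap

lemma reg_apply (g : G) (x : Hs 𝕜 G) (h : G) : reg 𝕜 g x h = x (g⁻¹ * h) := by
  simp [reg, LinearIsometryEquiv.piLpCongrLeft_apply, Equiv.piCongrLeft']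

lemma reg_mul (g h : G) : reg 𝕜 (g * h) = reg 𝕜 g * reg 𝕜 h := by
  ext x i; simp [reg_apply, mul_assoc]
lemma reg_one : reg 𝕜 (1 : G) = 1 := by
  ext x i; simp [reg_apply]
lemma norm_reg_apply (g : G) (x : Hs 𝕜 G) : ‖reg 𝕜 g x‖ = ‖x‖ := by
  exact LinearIsometryEquiv.norm_map (LinearIsometryEquiv.piLpCongrLeft 2 𝕜 𝕜 (Equiv.mulLeft g)) x
lemma norm_reg_le (g : G) : ‖reg 𝕜 g‖ ≤ 1 :=
  ContinuousLinearMap.opNorm_le_bound _ zero_le_one fun x => by simp [norm_reg_apply]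
lemma reg_single [DecidableEq G] (g h : G) :
    reg 𝕜 g (EuclideanSpace.single h 1) = EuclideanSpace.single (g * h) 1 := by
  ext i; simp [reg_apply, Pi.single_apply, inv_mul_eq_iff_eq_mul]

def tau (y : Ms 𝕜 G) : 𝕜 := (Fintype.card G : 𝕜)⁻¹ * LinearMap.trace 𝕜 _ (y : Hs 𝕜 G →ₗ[𝕜] Hs 𝕜 G)

lemma tau_add (x y : Ms 𝕜 G) : tau 𝕜 (x + y) = tau 𝕜 x + tau 𝕜 y := by
  simp [tau, mul_add]
lemma tau_smul (c : 𝕜) (y : Ms 𝕜 G) : tau 𝕜 (c • y) = c * tau 𝕜 y := by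
  simp [tau]; ring
lemma tau_mul_comm (x y : Ms 𝕜 G) : tau 𝕜 (x * y) = tau 𝕜 (y * x) := by
  unfold tau; congr 1
  exact LinearMap.trace_mul_comm 𝕜 (x : Hs 𝕜 G →ₗ[𝕜] Hs 𝕜 G) y
lemma tau_one : tau 𝕜 (1 : Ms 𝕜 G) = 1 := by
  unfold tau
  have : ((1 : Ms 𝕜 G) : Hs 𝕜 G →ₗ[𝕜] Hs 𝕜 G) = 1 := rfl
  rw [this, LinearMap.trace_one]
  simp [Fintype.card_ne_zero]
lemma tau_eq [DecidableEq G] (y : Ms 𝕜 G) :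
    tau 𝕜 y = (Fintype.card G : 𝕜)⁻¹ * ∑ h : G, y (EuclideanSpace.single h 1) h := by
  unfold tau
  rw [LinearMap.trace_eq_sum_inner _ (EuclideanSpace.basisFun G 𝕜)]
  simp [EuclideanSpace.inner_single_left]
lemma norm_tau_le (y : Ms 𝕜 G) : ‖tau 𝕜 y‖ ≤ ‖y‖ := by
  classical
  rw [tau_eq, norm_mul, norm_inv, RCLike.norm_natCast]
  have : ‖∑ h : G, y (EuclideanSpace.single h 1) h‖ ≤ ∑ h : G, ‖y‖ := by
    refine (norm_sum_le _ _).trans (Finset.sum_le_sum fun h _ => ?_)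
    refine (PiLp.norm_apply_le _ _).trans ((y.le_opNorm _).trans ?_)
    simp
  have hc : (0:ℝ) < Fintype.card G := by exact_mod_cast Fintype.card_pos
  rw [inv_mul_le_iff₀ hc]
  simpa using this

end Reg
end SzAP

namespace SzAP

section
variable (𝕜 : Type*) [RCLike 𝕜] {Γ : Type} [Group Γ] {G : ℕ → Type} [∀ N, Group (G N)]
  [∀ N, Fintype (G N)] (red : ∀ N, Γ →* G N)

instance instNontrivHs (G : Type) [Group G] [Fintype G] : Nontrivial (Hs 𝕜 G) :=
  inferInstance

lemma Ms_smul_mul {G : Type} [Fintype G] (c : 𝕜) (x y : Ms 𝕜 G) : c • x * y = c • (x * y) := rfl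
lemma Ms_mul_smul {G : Type} [Fintype G] (c : 𝕜) (x y : Ms 𝕜 G) : x * c • y = c • (x * y) := by
  ext1 v; exact map_smul x c (y v)

def XX (G : ℕ → Type) [∀ N, Group (G N)] [∀ N, Fintype (G N)] : Type _ := lp (fun N => Ms 𝕜 (G N)) ∞

instance : NormedRing (XX 𝕜 G) := inferInstanceAs (NormedRing (lp (fun N => Ms 𝕜 (G N)) ∞))
instance : NormedAlgebra 𝕜 (XX 𝕜 G) :=
  inferInstanceAs (NormedAlgebra 𝕜 (lp (fun N => Ms 𝕜 (G N)) ∞))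

/-- evaluation -/
def ev (N : ℕ) : XX 𝕜 G →ₐ[𝕜] Ms 𝕜 (G N) where
  toFun x := (show lp (fun N => Ms 𝕜 (G N)) ∞ from x) N
  map_one' := rfl
  map_mul' _ _ := rfl
  map_zero' := rfl
  map_add' _ _ := rfl
  commutes' _ := rfl

lemma XX.ext {x y : XX 𝕜 G} (h : ∀ N, ev 𝕜 N x = ev 𝕜 N y) : x = y :=
  lp.ext (funext h)

lemma XX.norm_le {x : XX 𝕜 G} {C : ℝ} (hC : 0 ≤ C) (h : ∀ N, ‖ev 𝕜 N x‖ ≤ C) : ‖x‖ ≤ C :=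
  lp.norm_le_of_forall_le (f := (show lp (fun N => Ms 𝕜 (G N)) ∞ from x)) hC h

lemma XX.norm_ev_le (x : XX 𝕜 G) (N : ℕ) : ‖ev 𝕜 N x‖ ≤ ‖x‖ :=
  lp.norm_apply_le_norm (by simp) (show lp (fun N => Ms 𝕜 (G N)) ∞ from x) N

def XX.mk (f : ∀ N, Ms 𝕜 (G N)) (C : ℝ) (h : ∀ N, ‖f N‖ ≤ C) : XX 𝕜 G :=
  (⟨f, memℓp_infty ⟨C, by rintro _ ⟨N, rfl⟩; exact h N⟩⟩ : lp (fun N => Ms 𝕜 (G N)) ∞)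

lemma XX.ev_mk (f : ∀ N, Ms 𝕜 (G N)) (C : ℝ) (h : ∀ N, ‖f N‖ ≤ C) (N : ℕ) :
    ev 𝕜 N (XX.mk 𝕜 f C h) = f N := rfl

def ppi (g : Γ) : XX 𝕜 G := XX.mk 𝕜 (fun N => reg 𝕜 (red N g)) 1 fun N => norm_reg_le 𝕜 _

lemma ppi_apply (g : Γ) (N : ℕ) : ev 𝕜 N (ppi 𝕜 red g : XX 𝕜 G) = reg 𝕜 (red N g) := rfl

lemma norm_ppi_le (g : Γ) : ‖ppi 𝕜 red g‖ ≤ 1 :=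
  XX.norm_le 𝕜 zero_le_one fun N => norm_reg_le 𝕜 _

def tS {N : ℕ} (S : XX 𝕜 G →L[𝕜] Ms 𝕜 (G N)) (g : Γ) : 𝕜 :=
  tau 𝕜 (reg 𝕜 (red N g)⁻¹ * S (ppi 𝕜 red g))

abbrev RA (Γ : Type) [Group Γ] := MonoidAlgebra ℝ Γ

abbrev sgl (g : Γ) : RA Γ := MonoidAlgebra.single g (1:ℝ)

def tH {N : ℕ} (S : XX 𝕜 G →L[𝕜] Ms 𝕜 (G N)) : RA Γ →ₗ[ℝ] 𝕜 :=
  (Finsupp.linearCombination ℝ (tS 𝕜 red S)).comp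
    (MonoidAlgebra.coeffLinearEquiv ℝ : RA Γ ≃ₗ[ℝ] (Γ →₀ ℝ)).toLinearMap

lemma tH_sgl {N : ℕ} (S : XX 𝕜 G →L[𝕜] Ms 𝕜 (G N)) (g : Γ) :
    tH 𝕜 red S (sgl g) = tS 𝕜 red S g := by
  change Finsupp.linearCombination ℝ (tS 𝕜 red S) (Finsupp.single g 1) = _
  simp

/-- shifting -/
def shiftS {N : ℕ} (S : XX 𝕜 G →L[𝕜] Ms 𝕜 (G N)) (g h : Γ) : XX 𝕜 G →L[𝕜] Ms 𝕜 (G N) :=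
  LinearMap.mkContinuous
    { toFun := fun y => reg 𝕜 (red N g)⁻¹ * S (ppi 𝕜 red g * y * ppi 𝕜 red h) * reg 𝕜 (red N h)⁻¹
      map_add' := fun x y => by simp [mul_add, add_mul]
      map_smul' := fun c x => by
        simp only [mul_smul_comm, smul_mul_assoc, map_smul, RingHom.id_apply, Ms_smul_mul, Ms_mul_smul] }
    ‖S‖ (fun y => by
      have h1 := norm_reg_le 𝕜 (red N g)⁻¹
      have h2 := norm_reg_le 𝕜 (red N h)⁻¹
      have h3 := norm_ppi_le 𝕜 red g
      have h4 := norm_ppi_le 𝕜 red h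
      calc _ ≤ ‖reg 𝕜 (red N g)⁻¹‖ * ‖S (ppi 𝕜 red g * y * ppi 𝕜 red h)‖ * ‖reg 𝕜 (red N h)⁻¹‖ := by
            refine (norm_mul_le _ _).trans ?_
            gcongr; exact norm_mul_le _ _
        _ ≤ 1 * (‖S‖ * (1 * ‖y‖ * 1)) * 1 := by
            gcongr
            refine (S.le_opNorm _).trans ?_
            gcongr
            refine (norm_mul_le _ _).trans ?_
            gcongr
            refine (norm_mul_le _ _).trans ?_
            gcongr
        _ = _ := by ring)

lemma shiftS_apply {N : ℕ} (S : XX 𝕜 G →L[𝕜] Ms 𝕜 (G N)) (g h : Γ) (y) :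
    shiftS 𝕜 red S g h y =
      reg 𝕜 (red N g)⁻¹ * S (ppi 𝕜 red g * y * ppi 𝕜 red h) * reg 𝕜 (red N h)⁻¹ := rfl

lemma ppi_mul (g h : Γ) : ppi 𝕜 red (g * h) = ppi 𝕜 red g * ppi 𝕜 red h := by
  refine XX.ext 𝕜 fun N => ?_
  simp [ppi_apply, reg_mul]

lemma tS_shift {N : ℕ} (S : XX 𝕜 G →L[𝕜] Ms 𝕜 (G N)) (g x h : Γ) :
    tS 𝕜 red S (g * x * h) = tS 𝕜 red (shiftS 𝕜 red S g h) x := by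
  simp only [tS, shiftS_apply, ppi_mul, map_mul, mul_inv_rev, reg_mul]
  rw [mul_assoc, tau_mul_comm]
  simp only [mul_assoc]

lemma tH_shift {N : ℕ} (S : XX 𝕜 G →L[𝕜] Ms 𝕜 (G N)) (g h : Γ) (m : RA Γ) :
    tH 𝕜 red S (sgl g * m * sgl h) = tH 𝕜 red (shiftS 𝕜 red S g h) m := by
  induction m using MonoidAlgebra.induction_linear with
  | zero => simp
  | add x y hx hy => rw [mul_add, add_mul, map_add, hx, hy, map_add]
  | single x r =>
    have h1 : (MonoidAlgebra.single x r : RA Γ) = r • sgl x := by simp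
    have h2 : sgl g * (r • sgl x) * sgl h = r • sgl (g * x * h) := by
      rw [mul_smul_comm, smul_mul_assoc]; simp [MonoidAlgebra.single_mul_single]
    rw [h1, h2, map_smul, map_smul, tH_sgl, tH_sgl, tS_shift]

def Small (k ε : ℝ) (m : RA Γ) : Prop :=
  ∃ F : Finset (XX 𝕜 G), (∀ y ∈ F, ‖y‖ ≤ ε) ∧
    ∀ (N : ℕ) (S : XX 𝕜 G →L[𝕜] Ms 𝕜 (G N)) (C : ℝ), 0 ≤ C → (∀ y ∈ F, ‖S y‖ ≤ C) →
      ‖tH 𝕜 red S m‖ ≤ k * C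

variable {k k' ε : ℝ} {m m' : RA Γ}

lemma Small.add (h : Small 𝕜 red k ε m) (h' : Small 𝕜 red k' ε m') :
    Small 𝕜 red (k + k') ε (m + m') := by
  classical
  obtain ⟨F, h1, h2⟩ := h
  obtain ⟨F', h1', h2'⟩ := h'
  refine ⟨F ∪ F', ?_, fun N S C hC h => ?_⟩
  · intro y hy
    rcases Finset.mem_union.1 hy with hy | hy
    exacts [h1 y hy, h1' y hy]
  · rw [map_add, add_mul]
    refine (norm_add_le _ _).trans (add_le_add ?_ ?_)
    · exact h2 N S C hC fun y hy => h y (Finset.mem_union_left _ hy)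
    · exact h2' N S C hC fun y hy => h y (Finset.mem_union_right _ hy)

lemma Small.smul (c : ℝ) (hc : 0 ≤ c) (h : Small 𝕜 red k ε m) : Small 𝕜 red (c * k) ε (c • m) := by
  obtain ⟨F, h1, h2⟩ := h
  refine ⟨F, h1, fun N S C hC h => ?_⟩
  rw [map_smul, norm_smul, Real.norm_of_nonneg hc, mul_assoc]
  exact mul_le_mul_of_nonneg_left (h2 N S C hC h) hc

lemma Small.neg (h : Small 𝕜 red k ε m) : Small 𝕜 red k ε (-m) := by
  obtain ⟨F, h1, h2⟩ := h
  refine ⟨F, h1, fun N S C hC h => ?_⟩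
  rw [map_neg, norm_neg]
  exact h2 N S C hC h

lemma Small.mono (hk : k ≤ k') (h : Small 𝕜 red k ε m) : Small 𝕜 red k' ε m := by
  obtain ⟨F, h1, h2⟩ := h
  exact ⟨F, h1, fun N S C hC h => (h2 N S C hC h).trans (by gcongr)⟩

lemma Small.zero : Small 𝕜 red 0 ε 0 := ⟨∅, by simp, by simp⟩

lemma small_convex (k ε : ℝ) : Convex ℝ {m : RA Γ | Small 𝕜 red k ε m} := by
  intro x hx y hy a b ha hb hab
  have := (Small.smul 𝕜 red a ha hx).add 𝕜 red (Small.smul 𝕜 red b hb hy)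
  rw [← add_mul, hab, one_mul] at this
  exact this

lemma Small.conj (g h : Γ) (hm : Small 𝕜 red k ε m) : Small 𝕜 red k ε (sgl g * m * sgl h) := by
  classical
  obtain ⟨F, h1, h2⟩ := hm
  refine ⟨F.image fun y => ppi 𝕜 red g * y * ppi 𝕜 red h, ?_, fun N S C hC hS => ?_⟩
  · intro y hy
    obtain ⟨z, hz, rfl⟩ := Finset.mem_image.1 hy
    have h3 := norm_ppi_le 𝕜 red g
    have h4 := norm_ppi_le 𝕜 red h
    calc _ ≤ ‖ppi 𝕜 red g‖ * ‖z‖ * ‖ppi 𝕜 red h‖ := by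
          refine (norm_mul_le _ _).trans ?_
          gcongr; exact norm_mul_le _ _
      _ ≤ 1 * ‖z‖ * 1 := by gcongr
      _ = ‖z‖ := by ring
      _ ≤ ε := h1 z hz
  · rw [tH_shift]
    refine h2 N _ C hC fun y hy => ?_
    rw [shiftS_apply]
    have h1 := norm_reg_le 𝕜 (red N g)⁻¹
    have h2 := norm_reg_le 𝕜 (red N h)⁻¹
    have h3 := hS _ (Finset.mem_image_of_mem _ hy)
    calc _ ≤ ‖reg 𝕜 (red N g)⁻¹‖ * ‖S (ppi 𝕜 red g * y * ppi 𝕜 red h)‖ * ‖reg 𝕜 (red N h)⁻¹‖ := by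
            refine (norm_mul_le _ _).trans ?_
            gcongr; exact norm_mul_le _ _
        _ ≤ 1 * C * 1 := by gcongr
        _ = C := by ring

def IsProb (a : RA Γ) : Prop := a ∈ convexHull ℝ (Set.range (sgl (Γ := Γ)))

lemma IsProb.sgl (g : Γ) : IsProb (sgl g) := subset_convexHull _ _ ⟨g, rfl⟩
lemma IsProb.one : IsProb (1 : RA Γ) := IsProb.sgl 1

/-- induction for probability elements -/
lemma IsProb.induct {s : Set (RA Γ)} (hs : Convex ℝ s) (h : ∀ g, SzAP.sgl g ∈ s) {a : RA Γ}
    (ha : IsProb a) : a ∈ s :=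
  convexHull_min (by rintro _ ⟨g, rfl⟩; exact h g) hs ha

lemma convex_preim (f : RA Γ →ₗ[ℝ] RA Γ) {s : Set (RA Γ)} (hs : Convex ℝ s) :
    Convex ℝ {a | f a ∈ s} := hs.linear_preimage f

lemma IsProb.mul {a b : RA Γ} (ha : IsProb a) (hb : IsProb b) : IsProb (a * b) := by
  refine IsProb.induct (s := {a | IsProb (a * b)})
    (convex_preim (LinearMap.mulRight ℝ b) (convex_convexHull ℝ _)) (fun g => ?_) ha
  refine IsProb.induct (s := {b | IsProb (SzAP.sgl g * b)})
    (convex_preim (LinearMap.mulLeft ℝ (SzAP.sgl g)) (convex_convexHull ℝ _)) (fun h => ?_) hb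
  simp only [Set.mem_setOf_eq, MonoidAlgebra.single_mul_single, mul_one]
  exact IsProb.sgl _

lemma Small.mul_left {a : RA Γ} (ha : IsProb a) (hm : Small 𝕜 red k ε m) :
    Small 𝕜 red k ε (a * m) := by
  refine IsProb.induct (s := {a | Small 𝕜 red k ε (a * m)})
    (convex_preim (LinearMap.mulRight ℝ m) (small_convex 𝕜 red k ε)) (fun g => ?_) ha
  have := hm.conj 𝕜 red g 1
  rwa [show sgl (1:Γ) = 1 from rfl, mul_one] at this

lemma Small.mul_right {a : RA Γ} (ha : IsProb a) (hm : Small 𝕜 red k ε m) :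
    Small 𝕜 red k ε (m * a) := by
  refine IsProb.induct (s := {a | Small 𝕜 red k ε (m * a)})
    (convex_preim (LinearMap.mulLeft ℝ m) (small_convex 𝕜 red k ε)) (fun g => ?_) ha
  have := hm.conj 𝕜 red 1 g
  rwa [show sgl (1:Γ) = 1 from rfl, one_mul] at this

lemma IsProb.small {a : RA Γ} (ha : IsProb a) : Small 𝕜 red 1 1 a := by
  refine IsProb.induct (small_convex 𝕜 red 1 1) (fun g => ?_) ha
  refine ⟨{ppi 𝕜 red g}, ?_, fun N S C hC h => ?_⟩
  · simpa using norm_ppi_le 𝕜 red g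
  · rw [tH_sgl, tS, one_mul]
    refine (norm_tau_le 𝕜 _).trans ((norm_mul_le _ _).trans ?_)
    have h1 := norm_reg_le 𝕜 (red N g)⁻¹
    have h2 := h _ (Finset.mem_singleton_self _)
    calc _ ≤ 1 * C := by gcongr
      _ = C := one_mul _

lemma IsProb.sum {P : Type*} [Fintype P] [Nonempty P] (f : P → RA Γ) (hf : ∀ i, IsProb (f i)) :
    IsProb (((Fintype.card P : ℝ)⁻¹) • ∑ i, f i) := by
  rw [Finset.smul_sum]
  refine (convex_convexHull ℝ _).sum_mem (fun _ _ => by positivity) ?_ fun i _ => hf i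
  simp

/-- Lemma (3) -/
lemma small_of_fourier {L : Type} [AddCommGroup L] [Module (ZMod 2) L] [Fintype L]
    (l : L → Γ) (hl : ∀ v w, l (v + w) = l v * l w) {P : Type} [Fintype P] (c : P → ℝ) (v : P → L)
    (ε : ℝ) (hε : 0 ≤ ε)
    (h : ∀ ξ : Module.Dual (ZMod 2) L, |∑ i, c i * sg (ξ (v i))| ≤ ε) :
    Small 𝕜 red 1 ε (∑ i, c i • sgl (l (v i))) := by
  classical
  haveI := Fintype.ofFinite (Module.Dual (ZMod 2) L)
  have hl0 : l 0 = 1 := by have := hl 0 0; simpa using this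
  have hinv : ∀ w, (l w)⁻¹ = l w := fun w => by
    rw [inv_eq_iff_mul_eq_one, ← hl, add_self2, hl0]
  let y : Module.Dual (ZMod 2) L → XX 𝕜 G := fun ξ =>
    ∑ i, ((c i * sg (ξ (v i)) : ℝ) : 𝕜) • ppi 𝕜 red (l (v i))
  have hy : ∀ ξ N, ev 𝕜 N (y ξ) = ∑ i, ((c i * sg (ξ (v i)) : ℝ) : 𝕜) • reg 𝕜 (red N (l (v i))) := by
    intro ξ N
    simp only [y, map_sum, map_smul, ppi_apply]
  let U : ∀ N, L → Ms 𝕜 (G N) := fun N w => reg 𝕜 (red N (l w))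
  have hU : ∀ N v w, U N (v + w) = U N v * U N w := by
    intro N v w; simp only [U, hl, map_mul, reg_mul]
  have hU0 : ∀ N, U N 0 = 1 := by intro N; simp only [U, hl0, map_one, reg_one]
  have hn : ∀ N v h, ‖U N v h‖ = ‖h‖ := by intro N v h; simp only [U, norm_reg_apply]
  refine ⟨Finset.univ.image y, ?_, fun N S C hC hS => ?_⟩
  · intro z hz
    obtain ⟨ξ, -, rfl⟩ := Finset.mem_image.1 hz
    refine XX.norm_le 𝕜 hε fun N => ?_
    rw [hy]
    refine norm_comb_le (U N) (hU N) (hU0 N) (hn N) _ v ε hε fun η => ?_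
    have := h (ξ + η)
    simpa only [LinearMap.add_apply, sg_add, mul_assoc] using this
  · have key := key_op (U N) (EuclideanSpace.basisFun (G N) 𝕜) (hU N) (hU0 N) (hn N)
      (fun ξ => S (y ξ)) C (fun ξ => hS _ (Finset.mem_image_of_mem _ (Finset.mem_univ ξ)))
    have e : tH 𝕜 red S (∑ i, c i • sgl (l (v i))) =
        (Fintype.card (G N) : 𝕜)⁻¹ * ∑ ξ, LinearMap.trace 𝕜 _
          ((pr (U N) ξ * S (y ξ) : Ms 𝕜 (G N)) : Hs 𝕜 (G N) →ₗ[𝕜] Hs 𝕜 (G N)) := by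
      rw [map_sum, Finset.mul_sum]
      have : ∀ ξ, (Fintype.card (G N) : 𝕜)⁻¹ * LinearMap.trace 𝕜 _
          ((pr (U N) ξ * S (y ξ) : Ms 𝕜 (G N)) : Hs 𝕜 (G N) →ₗ[𝕜] Hs 𝕜 (G N)) =
          ∑ i, ((c i * sg (ξ (v i)) : ℝ) : 𝕜) *
            tau 𝕜 (pr (U N) ξ * S (ppi 𝕜 red (l (v i)))) := by
        intro ξ
        change tau 𝕜 (pr (U N) ξ * S (y ξ)) = _
        simp only [y, map_sum, map_smul, Finset.mul_sum, mul_smul_comm]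
        have hs : ∀ f : P → Ms 𝕜 (G N), tau 𝕜 (∑ i, f i) = ∑ i, tau 𝕜 (f i) :=
          fun f => map_sum (⟨⟨tau 𝕜, by simp [tau]⟩, tau_add 𝕜⟩ : Ms 𝕜 (G N) →+ 𝕜) f _
        simp only [hs, tau_smul]
      simp only [this]
      rw [Finset.sum_comm]
      refine Finset.sum_congr rfl fun i _ => ?_
      rw [map_smul, tH_sgl, tS, ← map_inv, hinv]
      change c i • tau 𝕜 (U N (v i) * _) = _
      rw [U_eq_sum (U N) (hU N) (hU0 N) (v i)]
      have hs : ∀ f : Module.Dual (ZMod 2) L → Ms 𝕜 (G N), tau 𝕜 (∑ i, f i) = ∑ i, tau 𝕜 (f i) :=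
          fun f => map_sum (⟨⟨tau 𝕜, by simp [tau]⟩, tau_add 𝕜⟩ : Ms 𝕜 (G N) →+ 𝕜) f _
      simp only [Finset.sum_mul, hs, Ms_smul_mul, tau_smul, RCLike.real_smul_eq_coe_mul,
        Finset.mul_sum, RCLike.ofReal_mul, mul_assoc]
    rw [e, norm_mul, norm_inv, RCLike.norm_natCast, one_mul]
    have hc : (0:ℝ) < Fintype.card (G N) := by exact_mod_cast Fintype.card_pos
    rw [inv_mul_le_iff₀ hc]
    exact key
end
end SzAP

namespace SzAP

section
variable {Γ : Type} [Group Γ]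
/-- averages -/
def av {P : Type} [Fintype P] (f : P → Γ) : RA Γ := ((Fintype.card P : ℝ)⁻¹) • ∑ i, sgl (f i)

lemma sgl_mul (g h : Γ) : sgl g * sgl h = sgl (g * h) := by
  simp [MonoidAlgebra.single_mul_single]

lemma sgl_one : sgl (1 : Γ) = 1 := rfl

lemma av_prob {P : Type} [Fintype P] [Nonempty P] (f : P → Γ) : IsProb (av f) :=
  IsProb.sum _ fun i => IsProb.sgl _

lemma av_mul_of {P : Type} [Fintype P] [Nonempty P] (f : P → Γ) (y : RA Γ)
    (h : ∀ i, sgl (f i) * y = y) : av f * y = y := by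
  unfold av
  rw [smul_mul_assoc, Finset.sum_mul]
  simp only [h, Finset.sum_const, Finset.card_univ]
  rw [← Nat.cast_smul_eq_nsmul ℝ, smul_smul, inv_mul_cancel₀, one_smul]
  exact_mod_cast Fintype.card_ne_zero

lemma mul_av_of {P : Type} [Fintype P] [Nonempty P] (f : P → Γ) (y : RA Γ)
    (h : ∀ i, y * sgl (f i) = y) : y * av f = y := by
  unfold av
  rw [mul_smul_comm, Finset.mul_sum]
  simp only [h, Finset.sum_const, Finset.card_univ]
  rw [← Nat.cast_smul_eq_nsmul ℝ, smul_smul, inv_mul_cancel₀, one_smul]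
  exact_mod_cast Fintype.card_ne_zero

lemma av_commute {P : Type} [Fintype P] (f : P → Γ) (y : RA Γ)
    (h : ∀ i, Commute (sgl (f i)) y) : Commute (av f) y := by
  unfold av
  refine Commute.smul_left ?_ _
  exact Commute.sum_left _ _ _ fun i _ => h i

variable {V W : Type} [AddCommGroup V] [Module (ZMod 2) V] [Fintype V]
  [AddCommGroup W] [Module (ZMod 2) W] [Fintype W]

section
variable (𝕜 : Type*) [RCLike 𝕜] {G : ℕ → Type} [∀ N, Group (G N)]
  [∀ N, Fintype (G N)] (red : ∀ N, Γ →* G N)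

lemma abs_avg_sg_le {P : Type} [Fintype P] (f : P → ZMod 2) :
    |∑ i, sg (f i)| ≤ Fintype.card P := by
  refine (Finset.abs_sum_le_sum_abs _ _).trans ?_
  simp [abs_sg]

lemma heis_fourier (b : V →ₗ[ZMod 2] V →ₗ[ZMod 2] W) (ψ : Module.Dual (ZMod 2) W)
    (hnd : ∀ x', (∀ x'', ψ (b x' x'') = 0) → x' = 0) (ξ₁ ξ₂ : Module.Dual (ZMod 2) V) :
    |∑ x' : V, ∑ x'' : V, sg (ξ₁ x' + ξ₂ x'' + ψ (b x' x''))| ≤ Fintype.card V := by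
  classical
  have h1 : ∀ x' : V, ∑ x'' : V, sg (ξ₁ x' + ξ₂ x'' + ψ (b x' x'')) =
      sg (ξ₁ x') * ∑ x'' : V, sg ((ξ₂ + ψ ∘ₗ b x') x'') := by
    intro x'
    rw [Finset.mul_sum]
    refine Finset.sum_congr rfl fun x'' _ => ?_
    simp [sg_add, mul_assoc]
  have h0 : ∀ x' : V, ξ₂ + ψ ∘ₗ b x' ≠ 0 → ∑ x'' : V, sg ((ξ₂ + ψ ∘ₗ b x') x'') = 0 := by
    intro x' h
    obtain ⟨w, hw⟩ : ∃ w, (ξ₂ + ψ ∘ₗ b x') w ≠ 0 := by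
      by_contra! h'
      exact h (LinearMap.ext h')
    exact sum_char (ξ₂ + ψ ∘ₗ b x').toAddMonoidHom ((zmod2_cases _).resolve_left hw)
  simp only [h1]
  by_cases hex : ∃ x₀, ξ₂ + ψ ∘ₗ b x₀ = 0
  · obtain ⟨x₀, hx₀⟩ := hex
    rw [Finset.sum_eq_single x₀]
    · rw [abs_mul, abs_sg, one_mul]
      exact abs_avg_sg_le _
    · intro x _ hx
      rw [h0, mul_zero]
      intro h
      apply hx
      have : x - x₀ = 0 := by
        refine hnd _ fun x'' => ?_
        have e1 := LinearMap.congr_fun h x''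
        have e2 := LinearMap.congr_fun hx₀ x''
        simp only [LinearMap.add_apply, LinearMap.comp_apply, LinearMap.zero_apply] at e1 e2
        rw [map_sub, LinearMap.sub_apply, map_sub]
        linear_combination e1 - e2
      exact sub_eq_zero.1 this
    · simp
  · push Not at hex
    rw [Finset.sum_eq_zero]
    · simp
    · intro x _
      rw [h0 x (hex x), mul_zero]

lemma heis_small (X Y : V → V → Γ) (ζ : W → Γ) (b : V →ₗ[ZMod 2] V →ₗ[ZMod 2] W)
    (hb : ∀ x y, b x y = b y x)
    (hX : ∀ a a' c c', X (a + a') (c + c') = X a c * X a' c')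
    (hY : ∀ a a' c c', Y (a + a') (c + c') = Y a c * Y a' c')
    (hζ : ∀ w w', ζ (w + w') = ζ w * ζ w')
    (hζX : ∀ w x x', Commute (ζ w) (X x x')) (hζY : ∀ w x x', Commute (ζ w) (Y x x'))
    (hYX : ∀ y y' x x', Y y y' * X x x' = X x x' * Y y y' * ζ (b x y + b x' y'))
    (Z : Submodule (ZMod 2) W) [Fintype Z] (c : W)
    (hnd : ∀ ψ : Module.Dual (ZMod 2) W, (∀ z ∈ Z, ψ z = 0) → ψ c = 1 →
      ∀ x', (∀ x'', ψ (b x' x'') = 0) → x' = 0) :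
    Small 𝕜 red 1 ((Fintype.card V : ℝ)⁻¹)
      (av (fun x : V × V => X x.1 x.2 * Y x.2 x.1) * av (fun z : Z => ζ z) *
        ((2:ℝ)⁻¹ • (1 - sgl (ζ c)))) := by
  classical
  have hcV : (0:ℝ) < Fintype.card V := by exact_mod_cast Fintype.card_pos
  have hcZ : (0:ℝ) < Fintype.card Z := by exact_mod_cast Fintype.card_pos
  let l : V × V × W → Γ := fun v => X v.1 v.2.1 * Y v.2.1 v.1 * ζ (v.2.2 + b v.1 v.2.1)
  have hl : ∀ v w, l (v + w) = l v * l w := by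
    rintro ⟨x1, y1, w1⟩ ⟨x2, y2, w2⟩
    simp only [l, Prod.mk_add_mk]
    have e : w1 + w2 + b (x1 + x2) (y1 + y2) =
        (b x2 y1 + b y2 x1) + ((w1 + b x1 y1) + (w2 + b x2 y2)) := by
      rw [hb y2 x1]; simp only [map_add, LinearMap.add_apply]; abel
    rw [e, hζ (b x2 y1 + b y2 x1), hζ (w1 + b x1 y1), hX, hY]
    have e1 := hYX y1 x1 x2 y2
    have e2 := (hζX (w1 + b x1 y1) x2 y2).eq
    have e3 := (hζY (w1 + b x1 y1) y2 x2).eq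
    have e4 := (hζY (b x2 y1 + b y2 x1) y2 x2).eq
    symm
    calc X x1 y1 * Y y1 x1 * ζ (w1 + b x1 y1) * (X x2 y2 * Y y2 x2 * ζ (w2 + b x2 y2))
        = X x1 y1 * Y y1 x1 * (ζ (w1 + b x1 y1) * X x2 y2) * Y y2 x2 * ζ (w2 + b x2 y2) := by group
      _ = X x1 y1 * (Y y1 x1 * X x2 y2) * (ζ (w1 + b x1 y1) * Y y2 x2) * ζ (w2 + b x2 y2) := by
          rw [e2]; group
      _ = X x1 y1 * X x2 y2 * Y y1 x1 * (ζ (b x2 y1 + b y2 x1) * Y y2 x2) * ζ (w1 + b x1 y1)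
            * ζ (w2 + b x2 y2) := by rw [e1, e3]; group
      _ = _ := by rw [e4]; group
  let P := (V × V) × Z × ZMod 2
  let cc : P → ℝ := fun i => (Fintype.card V : ℝ)⁻¹ * (Fintype.card V : ℝ)⁻¹ *
    (Fintype.card Z : ℝ)⁻¹ * 2⁻¹ * sg i.2.2
  let v : P → V × V × W := fun i => (i.1.1, i.1.2, b i.1.1 i.1.2 + (i.2.1 + i.2.2 • c))
  have key := small_of_fourier 𝕜 red l hl cc v ((Fintype.card V : ℝ)⁻¹) (by positivity) ?_
  · convert key using 1
    have hlv : ∀ i : P, sgl (l (v i)) =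
        sgl (X i.1.1 i.1.2 * Y i.1.2 i.1.1) * (sgl (ζ i.2.1) * sgl (ζ (i.2.2 • c))) := by
      rintro ⟨⟨x, y⟩, z, d⟩
      simp only [l, v, sgl_mul]
      rw [add_right_comm (b x y), add_self2, zero_add, hζ]
    simp only [hlv]
    have hζ0 : ζ 0 = 1 := by have := hζ 0 0; simpa using this
    have h2 : ∀ f : ZMod 2 → RA Γ, ∑ d, f d = f 0 + f 1 := fun f => Fin.sum_univ_two f
    rw [Fintype.sum_prod_type]
    simp only [Fintype.sum_prod_type (γ := RA Γ) (α₁ := Z)]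
    have h3 : ∀ (i : V × V) (z : Z), ∑ d : ZMod 2, cc (i, z, d) •
        (sgl (X i.1 i.2 * Y i.2 i.1) * (sgl (ζ z) * sgl (ζ (d • c)))) =
        (((Fintype.card V : ℝ)⁻¹ * (Fintype.card V : ℝ)⁻¹) • sgl (X i.1 i.2 * Y i.2 i.1)) *
          (((Fintype.card Z : ℝ)⁻¹ • sgl (ζ z)) * ((2:ℝ)⁻¹ • (1 - sgl (ζ c)))) := by
      intro i z
      rw [h2]
      simp only [cc, sg_zero, sg_one, zero_smul, one_smul, hζ0, sgl_one]
      simp only [smul_mul_assoc, mul_smul_comm, smul_smul, mul_sub, smul_sub, mul_one, mul_neg,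
        neg_smul, ← sub_eq_add_neg]
      congr 2 <;> ring
    simp only [h3]
    simp only [← Finset.mul_sum, ← Finset.sum_mul, ← Finset.smul_sum]
    simp only [av, Fintype.card_prod, Nat.cast_mul, mul_inv, mul_assoc]
  · intro ξ
    set ξ₁ : Module.Dual (ZMod 2) V := ξ ∘ₗ LinearMap.inl (ZMod 2) V (V × W) with h1
    set ξ₂ : Module.Dual (ZMod 2) V := ξ ∘ₗ (LinearMap.inr (ZMod 2) V (V × W) ∘ₗ
      LinearMap.inl (ZMod 2) V W) with h2
    set ψ : Module.Dual (ZMod 2) W := ξ ∘ₗ (LinearMap.inr (ZMod 2) V (V × W) ∘ₗ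
      LinearMap.inr (ZMod 2) V W) with h3
    have hξ : ∀ x y w, ξ (x, y, w) = ξ₁ x + ξ₂ y + ψ w := by
      intro x y w
      simp only [h1, h2, h3, LinearMap.comp_apply, ← map_add]
      simp
    have e : ∑ i, cc i * sg (ξ (v i)) =
        (Fintype.card V : ℝ)⁻¹ * ((Fintype.card V : ℝ)⁻¹ *
          (∑ x' : V, ∑ x'' : V, sg (ξ₁ x' + ξ₂ x'' + ψ (b x' x'')))) *
        ((Fintype.card Z : ℝ)⁻¹ * ∑ z : Z, sg (ψ z)) * (2⁻¹ * (1 - sg (ψ c))) := by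
      have h2 : ∀ f : ZMod 2 → ℝ, ∑ d, f d = f 0 + f 1 := fun f => Fin.sum_univ_two f
      rw [Fintype.sum_prod_type]
      simp only [Fintype.sum_prod_type (γ := ℝ) (α₁ := Z)]
      have h3 : ∀ (i : V × V) (z : Z), ∑ d : ZMod 2, cc (i, z, d) * sg (ξ (v (i, z, d))) =
          (Fintype.card V : ℝ)⁻¹ * ((Fintype.card V : ℝ)⁻¹ *
            sg (ξ₁ i.1 + ξ₂ i.2 + ψ (b i.1 i.2))) * ((Fintype.card Z : ℝ)⁻¹ * sg (ψ z)) *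
            (2⁻¹ * (1 - sg (ψ c))) := by
        intro i z
        rw [h2]
        simp only [cc, v, hξ, sg_zero, sg_one, zero_smul, one_smul, map_add, sg_add, map_zero]
        ring
      simp only [h3]
      simp only [← Finset.mul_sum, ← Finset.sum_mul]
      rw [Fintype.sum_prod_type]
    rw [e]
    by_cases hc : ψ c = 0
    · rw [hc, sg_zero]; simp; 
    have hc1 := (zmod2_cases _).resolve_left hc
    by_cases hZ : ∀ z ∈ Z, ψ z = 0
    · have hf := heis_fourier b ψ (hnd ψ hZ hc1) ξ₁ ξ₂
      rw [abs_mul, abs_mul, abs_mul, abs_mul, abs_of_pos (inv_pos.2 hcV)]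
      have a1 : (Fintype.card V : ℝ)⁻¹ * |∑ x' : V, ∑ x'' : V, sg (ξ₁ x' + ξ₂ x'' + ψ (b x' x''))|
          ≤ 1 := by
        rw [inv_mul_le_iff₀ hcV, mul_one]; exact hf
      have a2 : |(Fintype.card Z : ℝ)⁻¹ * ∑ z : Z, sg (ψ z)| ≤ 1 := by
        rw [abs_mul, abs_of_pos (inv_pos.2 hcZ), inv_mul_le_iff₀ hcZ, mul_one]
        exact abs_avg_sg_le _
      have a3 : |2⁻¹ * (1 - sg (ψ c))| = 1 := by rw [hc1, sg_one]; norm_num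
      rw [a3, mul_one]
      calc _ ≤ (Fintype.card V : ℝ)⁻¹ * 1 * 1 := by gcongr
        _ = _ := by ring
    · push Not at hZ
      obtain ⟨z, hz, hz'⟩ := hZ
      have : ∑ z : Z, sg (ψ z) = 0 :=
        sum_char (ψ ∘ₗ Z.subtype).toAddMonoidHom (w := (⟨z, hz⟩ : Z))
          ((zmod2_cases _).resolve_left hz')
      rw [this]; simp
end

end
end SzAP

namespace SzAP
open Polynomial

abbrev Pol := Polynomial (ZMod 2)
abbrev AA := Matrix (Fin 2) (Fin 2) Pol
abbrev dlt (d : ℕ) : Submodule (ZMod 2) Pol := degreeLT (ZMod 2) d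

instance (d : ℕ) : Finite (dlt d) := Finite.of_equiv _ (degreeLTEquiv (ZMod 2) d).toEquiv.symm
instance (d : ℕ) : Fintype (dlt d) := Fintype.ofFinite _

lemma card_dlt (d : ℕ) : Fintype.card (dlt d) = 2 ^ d := by
  rw [Fintype.card_congr (degreeLTEquiv (ZMod 2) d).toEquiv]
  simp [ZMod.card]

lemma mem_dlt_iff {p : Pol} {d : ℕ} : p ∈ dlt d ↔ p = 0 ∨ p.natDegree < d := by
  rw [mem_degreeLT]
  by_cases h : p = 0
  · simp [h, WithBot.bot_lt_coe]
  · simp [h, natDegree_lt_iff_degree_lt h]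

lemma mul_mem_dlt {p q : Pol} {a b c : ℕ} (hp : p ∈ dlt a) (hq : q ∈ dlt b) (h : a + b ≤ c + 1) :
    p * q ∈ dlt c := by
  rw [mem_dlt_iff] at *
  rcases hp with rfl | hp
  · simp
  rcases hq with rfl | hq
  · simp
  right
  have := natDegree_mul_le (p := p) (q := q)
  omega

lemma X_pow_mem_dlt {a b : ℕ} (h : a < b) : (X ^ a : Pol) ∈ dlt b := by
  rw [mem_dlt_iff]; right; simpa using h

lemma dlt_mono {a b : ℕ} (h : a ≤ b) : dlt a ≤ dlt b := degreeLT_mono h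

/-- matrices with entries of degree `< d` -/
def Vd (d : ℕ) : AddSubgroup AA where
  carrier := {M | ∀ i j, M i j ∈ dlt d}
  add_mem' hx hy i j := (dlt d).add_mem (hx i j) (hy i j)
  zero_mem' i j := (dlt d).zero_mem
  neg_mem' hx i j := (dlt d).neg_mem (hx i j)

lemma mem_Vd {M : AA} {d : ℕ} : M ∈ Vd d ↔ ∀ i j, M i j ∈ dlt d := Iff.rfl

instance (d : ℕ) : Finite (Vd d) := by
  refine Finite.of_injective (fun M : Vd d => fun i j => (⟨M.1 i j, M.2 i j⟩ : dlt d)) ?_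
  intro M N h
  ext1; ext1 i j
  have := congrFun (congrFun h i) j
  exact congrArg Subtype.val this
instance (d : ℕ) : Fintype (Vd d) := Fintype.ofFinite _

lemma Vd_mono {a b : ℕ} (h : a ≤ b) : Vd a ≤ Vd b := fun M hM i j => dlt_mono h (hM i j)

lemma mul_mem_Vd {M N : AA} {a b c : ℕ} (hM : M ∈ Vd a) (hN : N ∈ Vd b) (h : a + b ≤ c + 1) :
    M * N ∈ Vd c := fun i j => by
  rw [Matrix.mul_apply]
  exact Submodule.sum_mem _ fun k _ => mul_mem_dlt (hM i k) (hN k j) h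

lemma single_mem_Vd {i j : Fin 2} {p : Pol} {d : ℕ} (hp : p ∈ dlt d) : Matrix.single i j p ∈ Vd d := by
  intro k l
  rw [Matrix.single_apply]
  split_ifs
  · exact hp
  · exact (dlt d).zero_mem

lemma AA_add_self (a : AA) : a + a = 0 := by
  ext i j : 2
  simp only [Matrix.add_apply, Matrix.zero_apply]
  exact CharTwo.add_self_eq_zero _

section
variable {Γ : Type} [Group Γ]

def Addv (e : AA → Γ) : Prop := ∀ a b, e (a + b) = e a * e b

lemma Addv.zero {e : AA → Γ} (h : Addv e) : e 0 = 1 := by have := h 0 0; simpa using this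

def u (e : AA → Γ) (d : ℕ) : RA Γ := av (fun v : Vd d => e v)

lemma u_prob (e : AA → Γ) (d : ℕ) : IsProb (u e d) := av_prob _

lemma u_left {e : AA → Γ} (he : Addv e) {d : ℕ} {v : AA} (hv : v ∈ Vd d) :
    sgl (e v) * u e d = u e d := by
  unfold u av
  rw [mul_smul_comm, Finset.mul_sum]
  congr 1
  rw [← Equiv.sum_comp (Equiv.addLeft (⟨v, hv⟩ : Vd d)) (fun w : Vd d => sgl (e w))]
  refine Finset.sum_congr rfl fun w _ => ?_
  rw [sgl_mul, ← he]; rfl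

lemma u_right {e : AA → Γ} (he : Addv e) {d : ℕ} {v : AA} (hv : v ∈ Vd d) :
    u e d * sgl (e v) = u e d := by
  unfold u av
  rw [smul_mul_assoc, Finset.sum_mul]
  congr 1
  rw [← Equiv.sum_comp (Equiv.addRight (⟨v, hv⟩ : Vd d)) (fun w : Vd d => sgl (e w))]
  refine Finset.sum_congr rfl fun w _ => ?_
  rw [sgl_mul, ← he]; rfl

lemma u_commute (e : AA → Γ) (d : ℕ) (g : Γ) (h : ∀ a, Commute (e a) g) :
    Commute (u e d) (sgl g) := by
  refine av_commute _ _ fun i => ?_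
  change sgl _ * sgl _ = sgl _ * sgl _
  rw [sgl_mul, sgl_mul, (h i).eq]

lemma u_transpose (e : AA → Γ) (d : ℕ) : u (fun a => e a.transpose) d = u e d := by
  unfold u av
  congr 1
  let f : Vd d ≃ Vd d :=
    { toFun := fun v => ⟨v.1.transpose, fun i j => v.2 j i⟩
      invFun := fun v => ⟨v.1.transpose, fun i j => v.2 j i⟩
      left_inv := fun v => rfl
      right_inv := fun v => rfl }
  exact Equiv.sum_comp f (fun v : Vd d => sgl (e v))

structure Heis (e1 e2 e3 : AA → Γ) : Prop where
  h1 : Addv e1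
  h2 : Addv e2
  h3 : Addv e3
  c31 : ∀ a b, Commute (e3 a) (e1 b)
  c32 : ∀ a b, Commute (e3 a) (e2 b)
  rel : ∀ a b, e2 b * e1 a = e1 a * e2 b * e3 (a * b)

variable {e1 e2 e3 : AA → Γ}

lemma Heis.reverse (h : Heis e1 e2 e3) :
    Heis (fun a => e2 a.transpose) (fun a => e1 a.transpose) (fun a => e3 a.transpose) where
  h1 a b := by simp only [Matrix.transpose_add, h.h2 _ _]
  h2 a b := by simp only [Matrix.transpose_add, h.h1 _ _]
  h3 a b := by simp only [Matrix.transpose_add, h.h3 _ _]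
  c31 a b := h.c32 _ _
  c32 a b := h.c31 _ _
  rel a b := by
    rw [h.rel, Matrix.transpose_mul, mul_assoc (e1 b.transpose * _), ← h.h3, AA_add_self, h.h3.zero,
      mul_one]

variable (𝕜 : Type*) [RCLike 𝕜] {G : ℕ → Type} [∀ N, Group (G N)]
  [∀ N, Fintype (G N)] (red : ∀ N, Γ →* G N)

lemma zmod2_lead {p : Pol} (hp : p ≠ 0) : p.Monic :=
  (zmod2_cases _).resolve_left (leadingCoeff_ne_zero.2 hp)

lemma heis_step_core (H : Heis e1 e2 e3) (r a b D : ℕ) (hr : 1 ≤ r) (hD : a + b + r = D + 1)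
    (κ μ : Fin 2) :
    Small 𝕜 red 1 ((2:ℝ) ^ r)⁻¹
      (av (fun x : dlt r × dlt r =>
          e1 (Matrix.single κ 0 (x.1.1 * X ^ a) + Matrix.single κ 1 (x.2.1 * X ^ a)) *
          e2 (Matrix.single 0 μ (x.2.1 * X ^ b) + Matrix.single 1 μ (x.1.1 * X ^ b))) *
        av (fun z : dlt D => e3 (Matrix.single κ μ z.1)) *
        ((2:ℝ)⁻¹ • (1 - sgl (e3 (Matrix.single κ μ (X ^ D)))))) := by
  classical
  let W := dlt (D + r)
  let Z : Submodule (ZMod 2) W := (dlt D).comap W.subtype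
  obtain ⟨B, hB⟩ : ∃ B : dlt r →ₗ[ZMod 2] dlt r →ₗ[ZMod 2] W,
      ∀ x y : dlt r, ((B x y : W) : Pol) = x.1 * y.1 * X ^ (a + b) := ⟨LinearMap.mk₂ (ZMod 2)
    (fun x y => ⟨x.1 * y.1 * X ^ (a + b), mul_mem_dlt (c := D + r) (mul_mem_dlt (c := r + r - 1) x.2 y.2 (by omega))
      (X_pow_mem_dlt (Nat.lt_succ_self _)) (by omega)⟩)
    (fun x x' y => by ext1; simp; ring) (fun c x y => by ext1; simp [mul_assoc])
    (fun x x' y => by ext1; simp; ring) (fun c x y => by ext1; simp),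
    fun x y => by rw [LinearMap.mk₂_apply]⟩
  haveI : Fintype Z := Fintype.ofFinite _
  let c : W := ⟨X ^ D, X_pow_mem_dlt (by omega)⟩
  have key := heis_small 𝕜 red
    (fun x x' : dlt r => e1 (Matrix.single κ 0 (x.1 * X ^ a) + Matrix.single κ 1 (x'.1 * X ^ a)))
    (fun y y' : dlt r => e2 (Matrix.single 0 μ (y.1 * X ^ b) + Matrix.single 1 μ (y'.1 * X ^ b)))
    (fun w : W => e3 (Matrix.single κ μ w.1)) B
    (fun x y => by ext1; simp only [hB]; ring)
    (fun x x' y y' => by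
      rw [← H.h1, Submodule.coe_add, Submodule.coe_add, add_mul, add_mul, Matrix.single_add,
        Matrix.single_add, add_add_add_comm])
    (fun x x' y y' => by
      rw [← H.h2, Submodule.coe_add, Submodule.coe_add, add_mul, add_mul, Matrix.single_add,
        Matrix.single_add, add_add_add_comm])
    (fun w w' => by
      rw [← H.h3, Submodule.coe_add, Matrix.single_add])
    (fun w x x' => H.c31 _ _) (fun w x x' => H.c32 _ _)
    (fun y y' x x' => by
      rw [H.rel]
      have hmul : (Matrix.single κ 0 (x.1 * X ^ a) + Matrix.single κ 1 (x'.1 * X ^ a) : AA) *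
          (Matrix.single 0 μ (y.1 * X ^ b) + Matrix.single 1 μ (y'.1 * X ^ b)) =
          Matrix.single κ μ ((B x y + B x' y' : W) : Pol) := by
        rw [add_mul, mul_add, mul_add, Matrix.single_mul_single_same,
          Matrix.single_mul_single_same, Matrix.single_mul_single_of_ne,
          Matrix.single_mul_single_of_ne, zero_add, add_zero,
          ← Matrix.single_add, Submodule.coe_add, hB, hB]
        · have : ∀ p q p' q' s t : Pol, p * s * (q * t) + p' * s * (q' * t) = p * q * (s * t) + p' * q' * (s * t) := by
            intros; ring
          rw [this, pow_add]
        · decide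
        · decide
      rw [hmul]) Z c ?_
  · have hV : (Fintype.card (dlt r) : ℝ)⁻¹ = ((2:ℝ) ^ r)⁻¹ := by rw [card_dlt]; norm_num
    rw [hV] at key
    have hZ : av (fun z : Z => e3 (Matrix.single κ μ z.1.1)) =
        av (fun z : dlt D => e3 (Matrix.single κ μ z.1)) := by
      let f : Z ≃ dlt D :=
        { toFun := fun z => ⟨z.1.1, z.2⟩
          invFun := fun z => ⟨⟨z.1, dlt_mono (by omega) z.2⟩, z.2⟩
          left_inv := fun z => rfl
          right_inv := fun z => rfl }
      unfold av
      rw [Fintype.card_congr f, ← Equiv.sum_comp f]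
      rfl
    rw [hZ] at key
    exact key
  · intro ψ hψ hc x hx
    by_contra hx0
    have hx0' : x.1 ≠ 0 := fun h => hx0 (Subtype.ext h)
    have hdeg : x.1.natDegree < r := (mem_dlt_iff.1 x.2).resolve_left hx0'
    have h1 := hx ⟨X ^ (r - 1 - x.1.natDegree), X_pow_mem_dlt (by omega)⟩
    set Q : Pol := x.1 * X ^ (r - 1 - x.1.natDegree) * X ^ (a + b) with hQ
    have hQm : Q.Monic := ((zmod2_lead hx0').mul (monic_X_pow _)).mul (monic_X_pow _)
    have hQd : Q.natDegree = D := by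
      rw [hQ, Monic.natDegree_mul ((zmod2_lead hx0').mul (monic_X_pow _)) (monic_X_pow _),
        Monic.natDegree_mul (zmod2_lead hx0') (monic_X_pow _)]
      simp; omega
    have hd : Q - X ^ D ∈ dlt D := by
      rw [mem_degreeLT]
      have hQdeg : Q.degree = D := by rw [degree_eq_natDegree hQm.ne_zero, hQd]
      have := degree_sub_lt (p := Q) (q := X ^ D) (by rw [hQdeg]; simp) hQm.ne_zero
        (by rw [hQm.leadingCoeff]; simp)
      rwa [hQdeg] at this
    set y : W := B x ⟨X ^ (r - 1 - x.1.natDegree), X_pow_mem_dlt (by omega)⟩ with hy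
    have hyc : y - c ∈ Z := by
      rw [Submodule.mem_comap, map_sub, Submodule.subtype_apply, Submodule.subtype_apply, hy, hB]
      exact hd
    have h2 := hψ (y - c) hyc
    rw [map_sub, h1, hc] at h2
    simp at h2

lemma sandwich {R : Type*} [Ring R] (α s t β T : R) (h1 : α * s = α) (h2 : t * β = β)
    (h3 : Commute T t) : α * (s * t * T) * β = α * T * β := by
  calc α * (s * t * T) * β = (α * s) * (t * T) * β := by simp only [mul_assoc]
    _ = α * T * (t * β) := by rw [h1, ← h3.eq]; simp only [mul_assoc]
    _ = _ := by rw [h2]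

lemma heis_step (H : Heis e1 e2 e3) (r a b D dα dβ : ℕ) (hr : 1 ≤ r) (hD : a + b + r = D + 1)
    (hα : a + r ≤ dα) (hβ : b + r ≤ dβ) (κ μ : Fin 2) (γ : RA Γ) (hγ : IsProb γ)
    (hγ2 : ∀ y, Commute γ (sgl (e2 y))) (hγ3 : ∀ z ∈ Vd D, sgl (e3 z) * γ = γ) :
    Small 𝕜 red 1 ((2:ℝ) ^ r)⁻¹
      (u e1 dα * γ * u e2 dβ -
        u e1 dα * ((2:ℝ)⁻¹ • (1 + sgl (e3 (Matrix.single κ μ (X ^ D)))) * γ) * u e2 dβ) := by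
  have core := heis_step_core 𝕜 red H r a b D hr hD κ μ
  have := (core.mul_left 𝕜 red (u_prob e1 dα)).mul_right 𝕜 red (hγ.mul (u_prob e2 dβ))
  convert this using 1
  set c := sgl (e3 (Matrix.single κ μ (X ^ D))) with hc
  set Z := av (fun z : dlt D => e3 (Matrix.single κ μ z.1)) with hZ
  have hZγ : Z * γ = γ := av_mul_of _ _ fun z => hγ3 _ (single_mem_Vd z.2)
  have hZc : Commute Z c := av_commute _ _ fun z => by
    change sgl _ * sgl _ = sgl _ * sgl _
    rw [sgl_mul, sgl_mul, ← H.h3, ← H.h3, add_comm]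
  set T := Z * ((2:ℝ)⁻¹ • (1 - c)) * γ with hT
  have hT' : T = (2:ℝ)⁻¹ • (γ - c * γ) := by
    rw [hT, mul_smul_comm, smul_mul_assoc, mul_sub, mul_one, sub_mul, hZγ, hZc.eq, mul_assoc, hZγ]
  have hTY : ∀ y, Commute T (sgl (e2 y)) := by
    intro y
    have hcy : Commute c (sgl (e2 y)) := by
      change sgl _ * sgl _ = sgl _ * sgl _
      rw [sgl_mul, sgl_mul, (H.c32 _ _).eq]
    rw [hT']
    exact ((hγ2 y).sub_left (hcy.mul_left (hγ2 y))).smul_left _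
  have main : ∀ x : dlt r × dlt r, u e1 dα * (sgl
          (e1 (Matrix.single κ 0 (x.1.1 * X ^ a) + Matrix.single κ 1 (x.2.1 * X ^ a)) *
          e2 (Matrix.single 0 μ (x.2.1 * X ^ b) + Matrix.single 1 μ (x.1.1 * X ^ b))) * T) * u e2 dβ
        = u e1 dα * T * u e2 dβ := by
    intro x
    have m1 : Matrix.single κ 0 (x.1.1 * X ^ a) + Matrix.single κ 1 (x.2.1 * X ^ a) ∈ Vd dα :=
      (Vd dα).add_mem
        (single_mem_Vd (mul_mem_dlt x.1.2 (X_pow_mem_dlt (Nat.lt_succ_self _)) (by omega)))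
        (single_mem_Vd (mul_mem_dlt x.2.2 (X_pow_mem_dlt (Nat.lt_succ_self _)) (by omega)))
    have m2 : Matrix.single 0 μ (x.2.1 * X ^ b) + Matrix.single 1 μ (x.1.1 * X ^ b) ∈ Vd dβ :=
      (Vd dβ).add_mem
        (single_mem_Vd (mul_mem_dlt x.2.2 (X_pow_mem_dlt (Nat.lt_succ_self _)) (by omega)))
        (single_mem_Vd (mul_mem_dlt x.1.2 (X_pow_mem_dlt (Nat.lt_succ_self _)) (by omega)))
    rw [← sgl_mul]
    exact sandwich _ _ _ _ _ (u_right H.h1 m1) (u_left H.h2 m2) (hTY _)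
  have main2 : u e1 dα * (av (fun x : dlt r × dlt r =>
          e1 (Matrix.single κ 0 (x.1.1 * X ^ a) + Matrix.single κ 1 (x.2.1 * X ^ a)) *
          e2 (Matrix.single 0 μ (x.2.1 * X ^ b) + Matrix.single 1 μ (x.1.1 * X ^ b))) * T) * u e2 dβ
        = u e1 dα * T * u e2 dβ := by
    unfold av
    rw [smul_mul_assoc, mul_smul_comm, smul_mul_assoc, Finset.sum_mul, Finset.mul_sum,
      Finset.sum_mul]
    simp only [main, Finset.sum_const, Finset.card_univ]
    rw [← Nat.cast_smul_eq_nsmul ℝ, smul_smul, inv_mul_cancel₀, one_smul]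
    exact_mod_cast Fintype.card_ne_zero
  have e : u e1 dα * (av (fun x : dlt r × dlt r =>
          e1 (Matrix.single κ 0 (x.1.1 * X ^ a) + Matrix.single κ 1 (x.2.1 * X ^ a)) *
          e2 (Matrix.single 0 μ (x.2.1 * X ^ b) + Matrix.single 1 μ (x.1.1 * X ^ b))) *
           Z * ((2:ℝ)⁻¹ • (1 - c))) * (γ * u e2 dβ) = u e1 dα * T * u e2 dβ := by
    rw [← main2, hT]; simp only [mul_assoc]
  have e5 : γ - (2:ℝ)⁻¹ • (1 + c) * γ = T := by
    rw [hT', smul_mul_assoc, add_mul, one_mul, smul_sub, smul_add, ← sub_sub]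
    have : γ - (2:ℝ)⁻¹ • γ = (2:ℝ)⁻¹ • γ := by
      nth_rewrite 1 [← one_smul ℝ γ]
      rw [← sub_smul]; norm_num
    rw [this]
  rw [e, ← sub_mul, ← mul_sub, e5]
end
end SzAP

namespace SzAP
open Polynomial
section
variable {Γ : Type} [Group Γ] {e1 e2 e3 : AA → Γ}

lemma Vd_succ_le {T : AddSubgroup AA} {D : ℕ} (h0 : Vd D ≤ T)
    (h1 : ∀ κ μ, Matrix.single κ μ (X ^ D : Pol) ∈ T) : Vd (D + 1) ≤ T := by
  intro v hv
  rw [Matrix.matrix_eq_sum_single v]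
  refine T.sum_mem fun i _ => T.sum_mem fun j _ => ?_
  have hp := hv i j
  rw [← Polynomial.monomial_add_erase (v i j) D, Matrix.single_add]
  refine T.add_mem ?_ (h0 (single_mem_Vd ?_))
  · rcases zmod2_cases ((v i j).coeff D) with h | h
    · rw [h]; simp
    · rw [h, monomial_one_right_eq_X_pow]; exact h1 i j
  · rw [mem_degreeLT] at hp ⊢
    rw [degree_lt_iff_coeff_zero] at hp ⊢
    intro m hm
    rw [coeff_erase]
    split_ifs with h
    · rfl
    · exact hp m (by omega)

/-- half-sum -/
def hf (e3 : AA → Γ) (c : AA) : RA Γ := (2:ℝ)⁻¹ • (1 + sgl (e3 c))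

lemma hf_prob (e3 : AA → Γ) (c : AA) : IsProb (hf e3 c) := by
  unfold hf
  have := (convex_convexHull ℝ (Set.range (sgl (Γ := Γ)))) IsProb.one (IsProb.sgl (e3 c))
    (a := (2:ℝ)⁻¹) (b := (2:ℝ)⁻¹) (by norm_num) (by norm_num) (by norm_num)
  rw [smul_add]; exact this

lemma hf_inv (h3 : Addv e3) (c : AA) : sgl (e3 c) * hf e3 c = hf e3 c := by
  unfold hf
  rw [mul_smul_comm, mul_add, sgl_mul, ← h3, AA_add_self, h3.zero, mul_one, sgl_one, add_comm]

lemma hf_comm (h3 : Addv e3) (c v : AA) : sgl (e3 v) * hf e3 c = hf e3 c * sgl (e3 v) := by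
  unfold hf
  rw [mul_smul_comm, mul_add, sgl_mul, ← h3, add_comm, smul_mul_assoc, add_mul, sgl_mul, ← h3,
    one_mul, mul_one, add_comm v, add_comm]

def invS (h3 : Addv e3) (γ : RA Γ) : AddSubgroup AA where
  carrier := {v | sgl (e3 v) * γ = γ}
  add_mem' {a b} ha hb := by
    change _ = _ at ha hb; change _ = _
    rw [h3, ← sgl_mul, mul_assoc, hb, ha]
  zero_mem' := by change _ = _; rw [h3.zero, sgl_one, one_mul]
  neg_mem' {a} ha := by
    change _ = _ at ha; change _ = _
    rwa [neg_eq_of_add_eq_zero_right (AA_add_self a)]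

lemma mem_invS (h3 : Addv e3) (γ : RA Γ) (v : AA) : v ∈ invS h3 γ ↔ sgl (e3 v) * γ = γ := Iff.rfl

lemma invS_step (h3 : Addv e3) (γ : RA Γ) (c : AA) : invS h3 γ ≤ invS h3 (hf e3 c * γ) := by
  intro v hv
  rw [mem_invS] at *
  rw [← mul_assoc, hf_comm h3, mul_assoc, hv]

lemma invS_self (h3 : Addv e3) (γ : RA Γ) (c : AA) : c ∈ invS h3 (hf e3 c * γ) := by
  rw [mem_invS, ← mul_assoc, hf_inv h3]

structure Good (h3 : Addv e3) (e2 : AA → Γ) (D : ℕ) (γ : RA Γ) : Prop where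
  prob : IsProb γ
  comm : ∀ y, Commute γ (sgl (e2 y))
  inv : Vd D ≤ invS h3 γ

lemma Good.step {D : ℕ} {γ : RA Γ} (H : Heis e1 e2 e3) (h : Good H.h3 e2 D γ) (c : AA) :
    Good H.h3 e2 D (hf e3 c * γ) where
  prob := (hf_prob _ _).mul h.prob
  comm y := by
    refine Commute.mul_left ?_ (h.comm y)
    unfold hf
    refine ((Commute.one_left _).add_left ?_).smul_left _
    change sgl _ * sgl _ = sgl _ * sgl _
    rw [sgl_mul, sgl_mul, (H.c32 _ _).eq]
  inv := h.inv.trans (invS_step _ _ _)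

lemma u_succ (h3 : Addv e3) (D : ℕ) : hf e3 (Matrix.single 1 1 (X ^ D)) *
    (hf e3 (Matrix.single 1 0 (X ^ D)) * (hf e3 (Matrix.single 0 1 (X ^ D)) *
      (hf e3 (Matrix.single 0 0 (X ^ D)) * u e3 D))) = u e3 (D + 1) := by
  set w := hf e3 (Matrix.single 1 1 (X ^ D)) *
    (hf e3 (Matrix.single 1 0 (X ^ D)) * (hf e3 (Matrix.single 0 1 (X ^ D)) *
      (hf e3 (Matrix.single 0 0 (X ^ D)) * u e3 D))) with hw
  have hinv : Vd (D + 1) ≤ invS h3 w := by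
    apply Vd_succ_le
    · refine le_trans ?_ ((invS_step h3 _ _).trans ((invS_step h3 _ _).trans ((invS_step h3 _ _).trans
        (invS_step h3 _ _))))
      intro v hv
      exact u_left h3 hv
    · intro κ μ
      fin_cases κ <;> fin_cases μ
      · exact invS_step h3 _ _ (invS_step h3 _ _ (invS_step h3 _ _ (invS_self h3 _ _)))
      · exact invS_step h3 _ _ (invS_step h3 _ _ (invS_self h3 _ _))
      · exact invS_step h3 _ _ (invS_self h3 _ _)
      · exact invS_self h3 _ _
  have h1 : u e3 (D + 1) * w = w := av_mul_of _ _ fun i => hinv i.2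
  have hu : ∀ κ μ : Fin 2, u e3 (D + 1) * hf e3 (Matrix.single κ μ (X ^ D)) = u e3 (D + 1) := by
    intro κ μ
    unfold hf
    rw [mul_smul_comm, mul_add, mul_one, u_right h3 (single_mem_Vd (X_pow_mem_dlt (Nat.lt_succ_self _))),
      ← two_smul ℝ, smul_smul]
    norm_num
  have h2 : u e3 (D + 1) * u e3 D = u e3 (D + 1) :=
    mul_av_of _ _ fun i => u_right h3 (Vd_mono (Nat.le_succ _) i.2)
  rw [← h1, hw]
  rw [← mul_assoc, hu, ← mul_assoc, hu, ← mul_assoc, hu, ← mul_assoc, hu, h2]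

variable (𝕜 : Type*) [RCLike 𝕜] {G : ℕ → Type} [∀ N, Group (G N)]
  [∀ N, Fintype (G N)] (red : ∀ N, Γ →* G N)

lemma Small.trans {k k' ε : ℝ} {a b c : RA Γ} (h : Small 𝕜 red k ε (a - b))
    (h' : Small 𝕜 red k' ε (b - c)) : Small 𝕜 red (k + k') ε (a - c) := by
  have := h.add 𝕜 red h'
  rwa [sub_add_sub_cancel] at this

lemma Small.symm {k ε : ℝ} {a b : RA Γ} (h : Small 𝕜 red k ε (a - b)) : Small 𝕜 red k ε (b - a) := by
  have := h.neg 𝕜 red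
  rwa [neg_sub] at this

lemma raise_one (H : Heis e1 e2 e3) (r D dα dβ : ℕ) (hr : 1 ≤ r) (hrD : r ≤ D + 1)
    (hα : r ≤ dα) (hβ : r ≤ dβ) (h : D + 1 + r ≤ dα + dβ) :
    Small 𝕜 red 4 ((2:ℝ) ^ r)⁻¹
      (u e1 dα * u e3 D * u e2 dβ - u e1 dα * u e3 (D + 1) * u e2 dβ) := by
  obtain ⟨a, b, hD, ha, hb⟩ : ∃ a b, a + b + r = D + 1 ∧ a + r ≤ dα ∧ b + r ≤ dβ := by
    by_cases h' : D + 1 ≤ dα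
    · exact ⟨D + 1 - r, 0, by omega, by omega, by omega⟩
    · exact ⟨dα - r, D + 1 - dα, by omega, by omega, by omega⟩
  have step : ∀ (κ μ : Fin 2) (γ : RA Γ), Good H.h3 e2 D γ → Small 𝕜 red 1 ((2:ℝ) ^ r)⁻¹
      (u e1 dα * γ * u e2 dβ - u e1 dα * (hf e3 (Matrix.single κ μ (X ^ D)) * γ) * u e2 dβ) :=
    fun κ μ γ hγ => heis_step 𝕜 red H r a b D dα dβ hr hD ha hb κ μ γ hγ.prob hγ.comm
      (fun z hz => hγ.inv hz)
  have g0 : Good H.h3 e2 D (u e3 D) := ⟨u_prob _ _, fun y => u_commute _ _ _ fun a => H.c32 _ _,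
    fun v hv => u_left H.h3 hv⟩
  have g1 := g0.step H (Matrix.single 0 0 (X ^ D))
  have g2 := g1.step H (Matrix.single 0 1 (X ^ D))
  have g3 := g2.step H (Matrix.single 1 0 (X ^ D))
  have := (((step 0 0 _ g0).trans 𝕜 red (step 0 1 _ g1)).trans 𝕜 red (step 1 0 _ g2)).trans 𝕜 red
    (step 1 1 _ g3)
  rw [u_succ H.h3] at this
  norm_num at this
  simpa using this

lemma raise (H : Heis e1 e2 e3) (r D dα dβ t : ℕ) (hr : 1 ≤ r) (hrD : r ≤ D + 1)
    (hα : r ≤ dα) (hβ : r ≤ dβ) (h : D + t + r ≤ dα + dβ) :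
    Small 𝕜 red (4 * t) ((2:ℝ) ^ r)⁻¹
      (u e1 dα * u e3 D * u e2 dβ - u e1 dα * u e3 (D + t) * u e2 dβ) := by
  induction t with
  | zero => simpa using Small.zero 𝕜 red
  | succ t ih =>
    have := (ih (by omega)).trans 𝕜 red
      (raise_one 𝕜 red H r (D + t) dα dβ hr (by omega) hα hβ (by omega))
    push_cast
    rw [mul_add, mul_one]
    exact this

lemma raise' (H : Heis e1 e2 e3) (r D dα dβ t : ℕ) (hr : 1 ≤ r) (hrD : r ≤ D + 1)
    (hα : r ≤ dα) (hβ : r ≤ dβ) (h : D + t + r ≤ dα + dβ) :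
    Small 𝕜 red (4 * t) ((2:ℝ) ^ r)⁻¹
      (u e2 dβ * u e3 D * u e1 dα - u e2 dβ * u e3 (D + t) * u e1 dα) := by
  have := raise 𝕜 red H.reverse r D dβ dα t hr hrD hβ hα (by omega)
  simpa only [u_transpose] using this

lemma flip (H : Heis e1 e2 e3) (d1 d2 d3 : ℕ) (h : d1 + d2 ≤ d3 + 1) :
    u e1 d1 * u e3 d3 * u e2 d2 = u e2 d2 * u e3 d3 * u e1 d1 := by
  have c1 : ∀ v, Commute (u e3 d3) (sgl (e1 v)) := fun v => u_commute _ _ _ fun a => H.c31 _ _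
  have c2 : ∀ v, Commute (u e3 d3) (sgl (e2 v)) := fun v => u_commute _ _ _ fun a => H.c32 _ _
  have cu1 : Commute (u e3 d3) (u e1 d1) := (av_commute _ _ fun i : Vd d1 => (c1 i.1).symm).symm
  have cu2 : Commute (u e3 d3) (u e2 d2) := (av_commute _ _ fun i : Vd d2 => (c2 i.1).symm).symm
  -- pointwise swap
  have sw : ∀ a ∈ Vd d1, ∀ b ∈ Vd d2, sgl (e2 b) * sgl (e1 a) * u e3 d3 =
      sgl (e1 a) * sgl (e2 b) * u e3 d3 := by
    intro a ha b hb
    rw [sgl_mul, H.rel, ← sgl_mul, mul_assoc, u_left H.h3 (mul_mem_Vd ha hb h), sgl_mul]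
  have : u e1 d1 * u e2 d2 * u e3 d3 = u e2 d2 * u e1 d1 * u e3 d3 := by
    clear cu1 cu2 c1 c2
    generalize u e3 d3 = w at sw ⊢
    unfold u av
    rw [smul_mul_smul_comm, smul_mul_smul_comm, smul_mul_assoc, smul_mul_assoc, Finset.sum_mul_sum,
      Finset.sum_mul_sum, mul_comm]
    congr 1
    rw [Finset.sum_comm]
    rw [Finset.sum_mul, Finset.sum_mul]
    refine Finset.sum_congr rfl fun b _ => ?_
    rw [Finset.sum_mul, Finset.sum_mul]
    exact Finset.sum_congr rfl fun a _ => (sw a a.2 b b.2).symm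
  rw [mul_assoc, cu2.eq, ← mul_assoc, this, mul_assoc, ← cu1.eq, ← mul_assoc]

end
end SzAP

namespace SzAP
open Polynomial
section
variable {Γ : Type} [Group Γ] 
variable (𝕜 : Type*) [RCLike 𝕜] {G : ℕ → Type} [∀ N, Group (G N)]
  [∀ N, Fintype (G N)] (red : ∀ N, Γ →* G N)

lemma Small.ctx {k ε : ℝ} {x y a b m m' : RA Γ} (h : Small 𝕜 red k ε (a - b)) (hx : IsProb x) (hy : IsProb y)
    (hm : m = x * a * y) (hm' : m' = x * b * y) : Small 𝕜 red k ε (m - m') := by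
  have := (h.mul_left 𝕜 red hx).mul_right 𝕜 red hy
  rwa [mul_sub, sub_mul, ← hm, ← hm'] at this

variable (e12 e13 e23 e21 e31 e32 : AA → Γ)

def PP (n : ℕ) : RA Γ := u e12 n * u e13 (2 * n) * u e23 n * u e21 n * u e31 (2 * n) * u e32 n

lemma PP_prob (n : ℕ) : IsProb (PP e12 e13 e23 e21 e31 e32 n) :=
  (((((u_prob _ _).mul (u_prob _ _)).mul (u_prob _ _)).mul (u_prob _ _)).mul (u_prob _ _)).mul
    (u_prob _ _)

lemma round (H123 : Heis e12 e23 e13) (H213 : Heis e21 e13 e23) (H231 : Heis e23 e31 e21)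
    (H321 : Heis e32 e21 e31) (H132 : Heis e13 e32 e12) (H312 : Heis e31 e12 e32)
    (n : ℕ) (hn : 2 ≤ n) : Small 𝕜 red (16 * n + 32) ((2:ℝ) ^ (n - 1))⁻¹
      (PP e12 e13 e23 e21 e31 e32 n - PP e12 e13 e23 e21 e31 e32 (n + 1)) := by
  have p := fun (e : AA → Γ) d => u_prob e d
  have s1 := (raise' 𝕜 red H213 (n - 1) n n (2 * n) (n + 1) (by omega) (by omega) (by omega)
    (by omega) (by omega)).ctx 𝕜 red (x := u e12 n) (y := u e31 (2 * n) * u e32 n)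
    (p _ _) ((p _ _).mul (p _ _)) rfl rfl
  have s2 := (raise 𝕜 red H231 (n - 1) n (2 * n + 1) (2 * n) (n + 1) (by omega) (by omega)
    (by omega) (by omega) (by omega)).ctx 𝕜 red (x := u e12 n * u e13 (2 * n)) (y := u e32 n)
    ((p _ _).mul (p _ _)) (p _ _) rfl rfl
  have s3 := (raise 𝕜 red H123 (n - 1) (2 * n) n (2 * n + 1) 2 (by omega) (by omega)
    (by omega) (by omega) (by omega)).ctx 𝕜 red (x := 1) (y := u e21 (2 * n + 1) * u e31 (2 * n) * u e32 n)
    IsProb.one (((p _ _).mul (p _ _)).mul (p _ _)) rfl rfl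
  have s4 := (raise' 𝕜 red H321 (n - 1) (2 * n) n (2 * n + 1) 2 (by omega) (by omega)
    (by omega) (by omega) (by omega)).ctx 𝕜 red (x := u e12 n * u e13 (2 * n + 2) * u e23 (2 * n + 1)) (y := 1)
    (((p _ _).mul (p _ _)).mul (p _ _)) IsProb.one rfl rfl
  have s5 := ((raise' 𝕜 red H213 (n - 1) (n + 1) (2 * n + 1) (2 * n + 2) n (by omega) (by omega) (by omega)
    (by omega) (by omega)).symm 𝕜 red).ctx 𝕜 red (x := u e12 n) (y := u e31 (2 * n + 2) * u e32 n)
    (p _ _) ((p _ _).mul (p _ _)) rfl rfl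
  have s6 := ((raise 𝕜 red H231 (n - 1) (n + 1) (n + 1) (2 * n + 2) n (by omega) (by omega)
    (by omega) (by omega) (by omega)).symm 𝕜 red).ctx 𝕜 red (x := u e12 n * u e13 (2 * n + 2)) (y := u e32 n)
    ((p _ _).mul (p _ _)) (p _ _) rfl rfl
  have s8 := (raise 𝕜 red H132 (n - 1) n (2 * n + 2) n 1 (by omega) (by omega)
    (by omega) (by omega) (by omega)).ctx 𝕜 red (x := u e23 (n + 1)) (y := u e31 (2 * n + 2) * u e21 (n + 1))
    (p _ _) ((p _ _).mul (p _ _)) rfl rfl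
  have s9 := (raise' 𝕜 red H312 (n - 1) n (2 * n + 2) (n + 1) 1 (by omega) (by omega)
    (by omega) (by omega) (by omega)).ctx 𝕜 red (x := u e23 (n + 1) * u e13 (2 * n + 2)) (y := u e21 (n + 1))
    ((p _ _).mul (p _ _)) (p _ _) rfl rfl
  have f1 := flip H123 n (n + 1) (2 * n + 2) (by omega)
  have f2 := flip H321 n (n + 1) (2 * n + 2) (by omega)
  have f3 := flip H123 (n + 1) (n + 1) (2 * n + 2) (by omega)
  have f4 := flip H321 (n + 1) (n + 1) (2 * n + 2) (by omega)
  have a1 : n + (n + 1) = 2 * n + 1 := by omega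
  have a2 : n + 1 + n = 2 * n + 1 := by omega
  have a3 : 2 * (n + 1) = 2 * n + 2 := by omega
  have m1 : u e12 n * (u e13 (2 * n + 2) * u e23 (n + 1) * u e21 (n + 1)) * (u e31 (2 * n + 2) * u e32 n)
    = u e23 (n + 1) * (u e13 (2 * n + 2) * u e12 n * u e32 n) * (u e31 (2 * n + 2) * u e21 (n + 1)) := by
    calc _ = (u e12 n * u e13 (2 * n + 2) * u e23 (n + 1)) * (u e21 (n + 1) * u e31 (2 * n + 2) * u e32 n) := by
          simp only [mul_assoc]
      _ = _ := by rw [f1, ← f2]; simp only [mul_assoc]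
  have m2 : PP e12 e13 e23 e21 e31 e32 (n + 1)
    = u e23 (n + 1) * u e13 (2 * n + 2) * (u e12 (n + 1) * u e32 (n + 1) * u e31 (2 * n + 2)) * u e21 (n + 1) := by
    unfold PP
    rw [a3]
    calc _ = (u e12 (n + 1) * u e13 (2 * n + 2) * u e23 (n + 1)) * (u e21 (n + 1) * u e31 (2 * n + 2) * u e32 (n + 1)) := by
          simp only [mul_assoc]
      _ = _ := by rw [f3, ← f4]; simp only [mul_assoc]
  rw [m2]
  rw [a1] at s1 s2
  rw [a2] at s5 s6
  simp only [mul_assoc, mul_one, one_mul] at s1 s2 s3 s4 s5 s6 s8 s9 m1 ⊢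
  unfold PP
  simp only [mul_assoc]
  rw [← m1] at s8
  have := ((((((s1.trans 𝕜 red s2).trans 𝕜 red s3).trans 𝕜 red s4).trans 𝕜 red s5).trans 𝕜 red s6).trans
    𝕜 red s8).trans 𝕜 red s9
  refine this.mono 𝕜 red ?_
  push_cast
  linarith
end

/-! the group -/
lemma oam {R : Type*} [Ring R] (x y : R) : (1 + x) * (1 + y) = 1 + (x + y) + x * y := by
  simp only [add_mul, mul_add, one_mul, mul_one]; abel

section
variable {A : Type} [Ring A]

def Eij (h2 : ∀ a : A, a + a = 0) (i j : Fin 3) (hij : i ≠ j) (a : A) : (Matrix (Fin 3) (Fin 3) A)ˣ where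
  val := 1 + Matrix.single i j a
  inv := 1 + Matrix.single i j a
  val_inv := by
    rw [oam, Matrix.single_mul_single_of_ne _ _ _ _ hij.symm, add_zero,
      ← Matrix.single_add, h2]; simp
  inv_val := by
    rw [oam, Matrix.single_mul_single_of_ne _ _ _ _ hij.symm, add_zero,
      ← Matrix.single_add, h2]; simp
end

abbrev GG := (Matrix (Fin 3) (Fin 3) AA)ˣ
abbrev eij (i j : Fin 3) (hij : i ≠ j) (a : AA) : GG := Eij AA_add_self i j hij a

lemma heis_eij (i j k : Fin 3) (hij : i ≠ j) (hjk : j ≠ k) (hik : i ≠ k) :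
    Heis (eij i j hij) (eij j k hjk) (eij i k hik) where
  h1 a b := by
    apply Units.ext
    change 1 + _ = (1 + _) * (1 + _)
    rw [oam, Matrix.single_mul_single_of_ne _ _ _ _ hij.symm, 
      Matrix.single_add]; abel
  h2 a b := by
    apply Units.ext
    change 1 + _ = (1 + _) * (1 + _)
    rw [oam, Matrix.single_mul_single_of_ne _ _ _ _ hjk.symm, 
      Matrix.single_add]; abel
  h3 a b := by
    apply Units.ext
    change 1 + _ = (1 + _) * (1 + _)
    rw [oam, Matrix.single_mul_single_of_ne _ _ _ _ hik.symm, 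
      Matrix.single_add]; abel
  c31 a b := by
    apply Units.ext
    change (1 + _) * (1 + _) = (1 + _) * (1 + _)
    rw [oam, Matrix.single_mul_single_of_ne _ _ _ _ hik.symm,
      oam, Matrix.single_mul_single_of_ne _ _ _ _ hij.symm]
    abel
  c32 a b := by
    apply Units.ext
    change (1 + _) * (1 + _) = (1 + _) * (1 + _)
    rw [oam, Matrix.single_mul_single_of_ne _ _ _ _ hjk.symm,
      oam, Matrix.single_mul_single_of_ne _ _ _ _ hik.symm]
    abel
  rel a b := by
    apply Units.ext
    change (1 + _) * (1 + _) = (1 + _) * (1 + _) * (1 + _)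
    have hz : Matrix.single i k (a * b) + Matrix.single i k (a * b) = (0 : Matrix (Fin 3) (Fin 3) AA) := by
      rw [← Matrix.single_add, AA_add_self, Matrix.single_zero]
    have e1 : (Matrix.single j k b : Matrix (Fin 3) (Fin 3) AA) * Matrix.single i j a = 0 :=
      Matrix.single_mul_single_of_ne _ _ _ _ hik.symm _
    have e2 : (Matrix.single i j a : Matrix (Fin 3) (Fin 3) AA) * Matrix.single i k (a * b) = 0 :=
      Matrix.single_mul_single_of_ne _ _ _ _ hij.symm _
    have e3 : (Matrix.single j k b : Matrix (Fin 3) (Fin 3) AA) * Matrix.single i k (a * b) = 0 :=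
      Matrix.single_mul_single_of_ne _ _ _ _ hik.symm _
    have e4 : (Matrix.single i j a : Matrix (Fin 3) (Fin 3) AA) * Matrix.single j k b =
      Matrix.single i k (a * b) := Matrix.single_mul_single_same _ _ _ _ _
    have e5 : (Matrix.single i k (a * b) : Matrix (Fin 3) (Fin 3) AA) * Matrix.single i k (a * b) = 0 :=
      Matrix.single_mul_single_of_ne _ _ _ _ hik.symm _
    generalize (Matrix.single i j a : Matrix (Fin 3) (Fin 3) AA) = x at *
    generalize (Matrix.single j k b : Matrix (Fin 3) (Fin 3) AA) = y at *
    generalize (Matrix.single i k (a * b) : Matrix (Fin 3) (Fin 3) AA) = z at *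
    have : (1 + x) * (1 + y) * (1 + z) = 1 + x + y + (z + z) + x * z + y * z + z * z := by
      simp only [add_mul, mul_add, one_mul, mul_one, e4]; abel
    rw [this, hz, e2, e3, e5]
    simp only [add_mul, mul_add, one_mul, mul_one, e1]; abel

abbrev Qt (N : ℕ) := Pol ⧸ Ideal.span {(X ^ N : Pol)}
abbrev GQ (N : ℕ) : Type := (Matrix (Fin 3) (Fin 3) (Matrix (Fin 2) (Fin 2) (Qt N)))ˣ

lemma Qt_finite (N : ℕ) : Finite (Qt N) := by
  refine Finite.of_surjective (fun x : dlt N => Ideal.Quotient.mk (Ideal.span {(X ^ N : Pol)}) x.1) ?_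
  intro y
  obtain ⟨p, rfl⟩ := Ideal.Quotient.mk_surjective y
  refine ⟨⟨p %ₘ X ^ N, ?_⟩, ?_⟩
  · rw [mem_degreeLT]
    have := degree_modByMonic_lt p (monic_X_pow (R := ZMod 2) N)
    simpa using this
  · rw [Ideal.Quotient.eq, Ideal.mem_span_singleton]
    refine ⟨- (p /ₘ X ^ N), ?_⟩
    have := modByMonic_add_div p (X ^ N : Pol)
    linear_combination this

instance (N : ℕ) : Finite (Qt N) := Qt_finite N
instance (N : ℕ) : Finite (Matrix (Fin 3) (Fin 3) (Matrix (Fin 2) (Fin 2) (Qt N))) := by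
  unfold Matrix; infer_instance
instance (N : ℕ) : Fintype (GQ N) := by
  have : Finite (GQ N) := Finite.of_injective _ Units.val_injective
  exact Fintype.ofFinite _

def rd (N : ℕ) : GG →* GQ N := Units.map
  ((((Ideal.Quotient.mk (Ideal.span {(X ^ N : Pol)})).mapMatrix.mapMatrix :
    Matrix (Fin 3) (Fin 3) AA →+* Matrix (Fin 3) (Fin 3) (Matrix (Fin 2) (Fin 2) (Qt N)))) : _ →* _)

lemma rd_inj (N n : ℕ) (h : n ≤ N) (i j : Fin 3) (hij : i ≠ j) :
    Function.Injective (fun v : Vd n => rd N (eij i j hij v)) := by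
  intro v w hvw
  have h1 : (rd N (eij i j hij v)).val i j = (rd N (eij i j hij w)).val i j := by
    have : rd N (eij i j hij v) = rd N (eij i j hij w) := hvw
    rw [this]
  have hval : ∀ v : AA, (rd N (eij i j hij v)).val i j = 
      (Ideal.Quotient.mk (Ideal.span {(X ^ N : Pol)})).mapMatrix v := by
    intro v
    change (Ideal.Quotient.mk (Ideal.span {(X ^ N : Pol)})).mapMatrix ((1 + Matrix.single i j v : Matrix (Fin 3) (Fin 3) AA) i j) = _
    rw [Matrix.add_apply, Matrix.one_apply_ne hij, Matrix.single_apply_same, zero_add]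
  rw [hval, hval] at h1
  ext1; ext1 k l
  have h2 := congrFun (congrFun h1 k) l
  change Ideal.Quotient.mk _ (v.1 k l) = Ideal.Quotient.mk _ (w.1 k l) at h2
  rw [Ideal.Quotient.eq, Ideal.mem_span_singleton] at h2
  by_contra hne
  have h3 := degree_le_of_dvd h2 (sub_ne_zero.2 hne)
  have h4 : v.1 k l - w.1 k l ∈ dlt n := (dlt n).sub_mem (v.2 k l) (w.2 k l)
  rw [mem_degreeLT] at h4
  rw [degree_X_pow] at h3
  have := lt_of_le_of_lt h3 h4
  rw [Nat.cast_lt] at this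
  omega

abbrev PG (n : ℕ) : RA GG := PP (eij 0 1 (by decide)) (eij 0 2 (by decide)) (eij 1 2 (by decide))
  (eij 1 0 (by decide)) (eij 2 0 (by decide)) (eij 2 1 (by decide)) n

lemma PG_round (𝕜 : Type*) [RCLike 𝕜] (n : ℕ) (hn : 2 ≤ n) :
    Small 𝕜 rd (16 * n + 32) ((2:ℝ) ^ (n - 1))⁻¹ (PG n - PG (n + 1)) :=
  round 𝕜 rd _ _ _ _ _ _ (heis_eij _ _ _ _ _ _) (heis_eij _ _ _ _ _ _) (heis_eij _ _ _ _ _ _)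
    (heis_eij _ _ _ _ _ _) (heis_eij _ _ _ _ _ _) (heis_eij _ _ _ _ _ _) n hn
end SzAP

namespace SzAP

section
variable (𝕜 : Type*) [RCLike 𝕜]

lemma bessel {G : Type} [Group G] [Fintype G] (y : Ms 𝕜 G) :
    ∑ g : G, ‖tau 𝕜 (reg 𝕜 g⁻¹ * y)‖ ^ 2 ≤ ‖y‖ ^ 2 := by
  classical
  have hc : (0:ℝ) < Fintype.card G := by exact_mod_cast Fintype.card_pos
  have h1 : ∀ g : G, ‖tau 𝕜 (reg 𝕜 g⁻¹ * y)‖ ^ 2 ≤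
      (Fintype.card G : ℝ)⁻¹ * ∑ h : G, ‖y (EuclideanSpace.single h 1) (g * h)‖ ^ 2 := by
    intro g
    have h2 : ‖tau 𝕜 (reg 𝕜 g⁻¹ * y)‖ ≤
        (Fintype.card G : ℝ)⁻¹ * ∑ h : G, ‖y (EuclideanSpace.single h 1) (g * h)‖ := by
      rw [tau_eq, norm_mul, norm_inv, RCLike.norm_natCast]
      gcongr
      refine (norm_sum_le _ _).trans (le_of_eq (Finset.sum_congr rfl fun h _ => ?_))
      have hm : (reg 𝕜 g⁻¹ * y) (EuclideanSpace.single h 1) = reg 𝕜 g⁻¹ (y (EuclideanSpace.single h 1)) := rfl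
      rw [hm, reg_apply, inv_inv]
    have h3 := sq_sum_le_card_mul_sum_sq (s := (Finset.univ : Finset G))
      (f := fun h => ‖y (EuclideanSpace.single h 1) (g * h)‖)
    rw [Finset.card_univ] at h3
    calc _ ≤ ((Fintype.card G : ℝ)⁻¹ * ∑ h : G, ‖y (EuclideanSpace.single h 1) (g * h)‖) ^ 2 := by
          gcongr
      _ = ((Fintype.card G : ℝ)⁻¹) ^ 2 * (∑ h : G, ‖y (EuclideanSpace.single h 1) (g * h)‖) ^ 2 := by
          ring
      _ ≤ ((Fintype.card G : ℝ)⁻¹) ^ 2 * (Fintype.card G * ∑ h : G, ‖y (EuclideanSpace.single h 1) (g * h)‖ ^ 2) := by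
          gcongr
      _ = _ := by field_simp
  calc _ ≤ ∑ g : G, (Fintype.card G : ℝ)⁻¹ * ∑ h : G, ‖y (EuclideanSpace.single h 1) (g * h)‖ ^ 2 :=
        Finset.sum_le_sum fun g _ => h1 g
    _ = (Fintype.card G : ℝ)⁻¹ * ∑ h : G, ∑ g : G, ‖y (EuclideanSpace.single h 1) (g * h)‖ ^ 2 := by
        rw [← Finset.mul_sum, Finset.sum_comm]
    _ ≤ (Fintype.card G : ℝ)⁻¹ * ∑ h : G, ‖y‖ ^ 2 := by
        gcongr with h
        have := Equiv.sum_comp (Equiv.mulRight h) (fun g => ‖y (EuclideanSpace.single h 1) g‖ ^ 2)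
        simp only [Equiv.coe_mulRight] at this
        rw [this, ← EuclideanSpace.norm_sq_eq]
        gcongr
        refine (y.le_opNorm _).trans ?_
        simp
    _ = ‖y‖ ^ 2 := by
        rw [Finset.sum_const, Finset.card_univ, nsmul_eq_mul]; field_simp

variable {Γ : Type} [Group Γ] {G : ℕ → Type} [∀ N, Group (G N)]
  [∀ N, Fintype (G N)] (red : ∀ N, Γ →* G N)

lemma tS_rank_one {N : ℕ} (φ : XX 𝕜 G →L[𝕜] 𝕜) (y : Ms 𝕜 (G N)) (g : Γ) :
    tS 𝕜 red (φ.smulRight y) g = φ (ppi 𝕜 red g) * tau 𝕜 (reg 𝕜 (red N g)⁻¹ * y) := by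
  unfold tS
  rw [ContinuousLinearMap.smulRight_apply, Ms_mul_smul, tau_smul]

lemma rank_one_aux {N : ℕ} {V : Type} [Fintype V] [Nonempty V] (e : V → Γ)
    (he : Function.Injective fun v => red N (e v))
    (φ : XX 𝕜 G →L[𝕜] 𝕜) (y : Ms 𝕜 (G N)) (g : Γ) :
    ‖tH 𝕜 red (φ.smulRight y) (av e * sgl g)‖ ≤ ‖φ‖ * ‖y‖ * (√(Fintype.card V))⁻¹ := by
  classical
  have hc : (0:ℝ) < Fintype.card V := by exact_mod_cast Fintype.card_pos
  set T : V → ℝ := fun v => ‖tau 𝕜 (reg 𝕜 (red N (e v * g))⁻¹ * y)‖ with hT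
  have h0 : av e * sgl g = (Fintype.card V : ℝ)⁻¹ • ∑ v, sgl (e v * g) := by
    unfold av
    rw [smul_mul_assoc, Finset.sum_mul]
    simp only [sgl_mul]
  have h1 : ‖tH 𝕜 red (φ.smulRight y) (av e * sgl g)‖ ≤
      (Fintype.card V : ℝ)⁻¹ * ∑ v, ‖φ‖ * T v := by
    rw [h0, map_smul, norm_smul, map_sum, Real.norm_of_nonneg (by positivity)]
    gcongr
    refine (norm_sum_le _ _).trans (Finset.sum_le_sum fun v _ => ?_)
    rw [tH_sgl, tS_rank_one, norm_mul]
    gcongr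
    refine (φ.le_opNorm _).trans ?_
    have := norm_ppi_le 𝕜 red (e v * g)
    nlinarith [norm_nonneg φ]
  have h2 : ∑ v, T v ^ 2 ≤ ‖y‖ ^ 2 := by
    refine le_trans ?_ (bessel 𝕜 y)
    have hinj : Function.Injective fun v => red N (e v * g) := by
      intro v w h
      simp only [map_mul, mul_left_inj] at h
      exact he h
    rw [← Finset.sum_image (s := Finset.univ) (g := fun v => red N (e v * g))
      (f := fun k => ‖tau 𝕜 (reg 𝕜 k⁻¹ * y)‖ ^ 2) hinj.injOn]
    exact Finset.sum_le_sum_of_subset_of_nonneg (Finset.subset_univ _) fun _ _ _ => by positivity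
  have h3 := sq_sum_le_card_mul_sum_sq (s := (Finset.univ : Finset V)) (f := T)
  rw [Finset.card_univ] at h3
  have h4 : ∑ v, T v ≤ √(Fintype.card V) * ‖y‖ := by
    refine abs_le_of_sq_le_sq' ?_ (by positivity) |>.2
    rw [mul_pow, Real.sq_sqrt hc.le]
    exact h3.trans (by gcongr)
  refine h1.trans ?_
  rw [← Finset.mul_sum]
  calc _ ≤ (Fintype.card V : ℝ)⁻¹ * (‖φ‖ * (√(Fintype.card V) * ‖y‖)) := by gcongr
    _ = _ := by
      have h5 : (Fintype.card V : ℝ)⁻¹ * √(Fintype.card V) = (√(Fintype.card V))⁻¹ := by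
        have := Real.mul_self_sqrt hc.le
        have h6 : √(Fintype.card V : ℝ) ≠ 0 := by positivity
        field_simp
        nlinarith
      rw [← h5]; ring

lemma rank_one_est' {N : ℕ} {V : Type} [Fintype V] [Nonempty V] (e : V → Γ)
    (he : Function.Injective fun v => red N (e v))
    (φ : XX 𝕜 G →L[𝕜] 𝕜) (y : Ms 𝕜 (G N)) {b : RA Γ} (hb : IsProb b) :
    ‖tH 𝕜 red (φ.smulRight y) (av e * b)‖ ≤ ‖φ‖ * ‖y‖ * (√(Fintype.card V))⁻¹ := by
  set C := ‖φ‖ * ‖y‖ * (√(Fintype.card V))⁻¹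
  have hconv : Convex ℝ {b : RA Γ | ‖tH 𝕜 red (φ.smulRight y) (av e * b)‖ ≤ C} := by
    intro b hb b' hb' s t hs ht hst
    change ‖_‖ ≤ C at hb hb'
    change ‖_‖ ≤ C
    rw [mul_add, mul_smul_comm, mul_smul_comm, map_add, map_smul, map_smul]
    refine (norm_add_le _ _).trans ?_
    rw [norm_smul, norm_smul, Real.norm_of_nonneg hs, Real.norm_of_nonneg ht]
    calc _ ≤ s * C + t * C := by gcongr
      _ = C := by rw [← add_mul, hst, one_mul]
  exact hb.induct hconv fun g => rank_one_aux 𝕜 red e he φ y g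

lemma tH_lin {N : ℕ} (m : RA Γ) (S S' : XX 𝕜 G →L[𝕜] Ms 𝕜 (G N)) :
    tH 𝕜 red (S + S') m = tH 𝕜 red S m + tH 𝕜 red S' m := by
  induction m using MonoidAlgebra.induction_linear with
  | zero => simp
  | add x y hx hy => rw [map_add, map_add, map_add, hx, hy]; ring
  | single x r =>
    have h1 : (MonoidAlgebra.single x r : RA Γ) = r • sgl x := by simp
    rw [h1, map_smul, map_smul, map_smul, tH_sgl, tH_sgl, tH_sgl, ← smul_add]
    congr 1
    unfold tS
    rw [ContinuousLinearMap.add_apply, mul_add, tau_add]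

lemma tH_sum {N : ℕ} (m : RA Γ) {ι : Type*} (s : Finset ι) (S : ι → XX 𝕜 G →L[𝕜] Ms 𝕜 (G N)) :
    tH 𝕜 red (∑ i ∈ s, S i) m = ∑ i ∈ s, tH 𝕜 red (S i) m := by
  classical
  induction s using Finset.induction_on with
  | empty =>
    have h := tH_lin 𝕜 red m (0 : XX 𝕜 G →L[𝕜] Ms 𝕜 (G N)) 0
    have h0 : (0 : XX 𝕜 G →L[𝕜] Ms 𝕜 (G N)) + 0 = 0 := by ext1; exact add_zero _
    rw [h0] at h
    rw [Finset.sum_empty, Finset.sum_empty]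
    exact left_eq_add.1 h
  | insert a s ha ih => rw [Finset.sum_insert ha, Finset.sum_insert ha, tH_lin, ih]

lemma tH_ev {N : ℕ} (S : XX 𝕜 G →L[𝕜] Ms 𝕜 (G N)) (hS : ∀ x, S x = ev 𝕜 N x) {m : RA Γ}
    (hm : IsProb m) : tH 𝕜 red S m = 1 := by
  have hconv : Convex ℝ {m : RA Γ | tH 𝕜 red S m = 1} := by
    intro b hb b' hb' s t hs ht hst
    change _ = _ at hb hb'
    change _ = _
    rw [map_add, map_smul, map_smul, hb, hb', ← add_smul, hst, one_smul]
  refine hm.induct hconv fun g => ?_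
  change _ = _
  rw [tH_sgl]
  unfold tS
  rw [hS, ppi_apply, ← reg_mul, inv_mul_cancel, reg_one, tau_one]

end

section
variable (𝕜 : Type*) [RCLike 𝕜]

lemma card_Vd_ge (n : ℕ) : n ≤ Fintype.card (Vd n) := by
  have h : Fintype.card (dlt n) ≤ Fintype.card (Vd n) := by
    refine Fintype.card_le_of_injective (fun p : dlt n =>
      (⟨Matrix.single 0 0 p.1, single_mem_Vd p.2⟩ : Vd n)) ?_
    intro p q h
    have h1 := congrArg (fun v : Vd n => v.1 0 0) h
    simp only [Matrix.single_apply_same] at h1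
    exact Subtype.ext h1
  rw [card_dlt] at h
  exact (Nat.lt_two_pow_self).le.trans h

lemma rank_one_est (n : ℕ) (hn : 0 < n) (φ : XX 𝕜 GQ →L[𝕜] 𝕜) (y : Ms 𝕜 (GQ n)) :
    ‖tH 𝕜 rd (φ.smulRight y) (PG n)‖ ≤ ‖φ‖ * ‖y‖ * (√n)⁻¹ := by
  have h := rank_one_est' 𝕜 rd (N := n) (fun v : Vd n => eij 0 1 (by decide) v) (rd_inj n n le_rfl 0 1 (by decide)) φ y
      (((((u_prob (eij 0 2 (by decide)) (2 * n)).mul (u_prob (eij 1 2 (by decide)) n)).mul (u_prob (eij 1 0 (by decide)) n)).mul (u_prob (eij 2 0 (by decide)) (2 * n))).mul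
    (u_prob (eij 2 1 (by decide)) n))
  have e : PG n = av (fun v : Vd n => eij 0 1 (by decide) v) *
    (u (eij 0 2 (by decide)) (2 * n) * u (eij 1 2 (by decide)) n * u (eij 1 0 (by decide)) n * u (eij 2 0 (by decide)) (2 * n) *
      u (eij 2 1 (by decide)) n) := by
    unfold PG PP
    simp only [mul_assoc]
    rfl
  rw [e]
  refine h.trans ?_
  gcongr
  exact_mod_cast card_Vd_ge n
end
end SzAP

namespace SzAP
open Filter Topology

section
variable {X : Type*} [NormedAddCommGroup X]

lemma compact_of_fin (F : ℕ → Finset X) (η : ℕ → ℝ) (hη : Tendsto η atTop (𝓝 0))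
    (h : ∀ m, ∀ y ∈ F m, ‖y‖ ≤ η m) : IsCompact (insert 0 (⋃ m, (F m : Set X))) := by
  let f : (Σ m, F m) → X := fun i => i.2.1
  have hr : Set.range f = ⋃ m, (F m : Set X) := by
    ext y
    simp only [Set.mem_range, Set.mem_iUnion, f]
    constructor
    · rintro ⟨⟨m, y, hy⟩, rfl⟩; exact ⟨m, hy⟩
    · rintro ⟨m, hy⟩; exact ⟨⟨m, y, hy⟩, rfl⟩
  rw [← hr]
  apply Filter.Tendsto.isCompact_insert_range_of_cofinite
  rw [Metric.tendsto_nhds]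
  intro ε hε
  rw [Filter.eventually_cofinite]
  have h1 := (hη.eventually (gt_mem_nhds hε))
  obtain ⟨n0, hn0⟩ := eventually_atTop.1 h1
  refine Set.Finite.subset (s := ⋃ m ∈ Finset.range n0, Set.range (fun y : F m => (⟨m, y⟩ : Σ m, F m))) ?_ ?_
  · exact Set.Finite.biUnion (Finset.finite_toSet _) fun m _ => Set.finite_range _
  · rintro ⟨m, y⟩ hy
    simp only [Set.mem_iUnion]
    refine ⟨m, ?_, y, rfl⟩
    rw [Finset.mem_range]
    by_contra! hm
    apply hy
    rw [dist_zero_right]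
    exact (h m y y.2).trans_lt (hn0 m hm)
end

section
variable {𝕜 : Type*} [RCLike 𝕜] {W : Type*} [NormedAddCommGroup W] [NormedSpace 𝕜 W]

lemma finite_rank_sum (T : W →L[𝕜] W) (hT : FiniteDimensional 𝕜 (LinearMap.range (T : W →ₗ[𝕜] W))) :
    ∃ (d : ℕ) (φ : Fin d → W →L[𝕜] 𝕜) (w : Fin d → W), ∀ x, T x = ∑ i, φ i x • w i := by
  let b := Module.finBasis 𝕜 (LinearMap.range (T : W →ₗ[𝕜] W))
  let T' : W →L[𝕜] LinearMap.range (T : W →ₗ[𝕜] W) := T.codRestrict _ (fun x => ⟨x, rfl⟩)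
  refine ⟨_, fun i => (LinearMap.toContinuousLinearMap (b.coord i)).comp T', fun i => (b i : W), ?_⟩
  intro x
  have := b.sum_repr (T' x)
  have h2 := congrArg Subtype.val this
  rw [AddSubmonoidClass.coe_finsetSum] at h2
  exact h2.symm

theorem no_ap (J : XX 𝕜 GQ →L[𝕜] W) (Q : ∀ N, W →L[𝕜] Ms 𝕜 (GQ N)) (C : ℝ)
    (hQ : ∀ N, ‖Q N‖ ≤ C) (hQJ : ∀ N x, Q N (J x) = ev 𝕜 N x) : ¬ HasAP 𝕜 W := by
  intro hAP
  have hC : 0 ≤ C := (ContinuousLinearMap.opNorm_nonneg (Q 0)).trans (hQ 0)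
  obtain ⟨F0, hF0, hS0⟩ := (PP_prob (eij 0 1 (by decide)) (eij 0 2 (by decide)) (eij 1 2 (by decide))
    (eij 1 0 (by decide)) (eij 2 0 (by decide)) (eij 2 1 (by decide)) 2).small 𝕜 rd
  choose F hF hS using fun m : ℕ => PG_round 𝕜 (m + 2) (by omega)
  classical
  set c : ℕ → ℝ := fun m => (3 / 2) ^ m with hc
  have hcpos : ∀ m, 0 < c m := fun m => by positivity
  let F' : ℕ → Finset (XX 𝕜 GQ) := fun m => (F m).image fun y => (c m : 𝕜) • y
  have hnc : ∀ m, ‖(c m : 𝕜)‖ = c m := fun m => by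
    rw [RCLike.norm_ofReal, abs_of_pos (hcpos m)]
  have hK1 : IsCompact (insert 0 (⋃ m, (F' m : Set (XX 𝕜 GQ)))) := by
    refine compact_of_fin F' (fun m => (3/4) ^ m) (tendsto_pow_atTop_nhds_zero_of_lt_one (by norm_num) (by norm_num)) ?_
    intro m y hy
    obtain ⟨z, hz, rfl⟩ := Finset.mem_image.1 hy
    rw [norm_smul, hnc]
    have := hF m z hz
    calc c m * ‖z‖ ≤ c m * ((2:ℝ) ^ (m + 2 - 1))⁻¹ := by gcongr
      _ = (3/4) ^ m * (1/2) := by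
        have : m + 2 - 1 = m + 1 := by omega
        rw [this, hc, pow_succ, show (3/4 : ℝ) = (3/2) * (1/2) by norm_num, mul_pow, one_div_pow]
        field_simp
      _ ≤ (3/4) ^ m := by
        have : (0:ℝ) ≤ (3/4) ^ m := by positivity
        linarith
  set K : Set (XX 𝕜 GQ) := insert 0 (⋃ m, (F' m : Set (XX 𝕜 GQ))) ∪ F0 with hKdef
  have hK : IsCompact (J '' K) := (hK1.union F0.finite_toSet.isCompact).image J.continuous
  have hsum : Summable fun m : ℕ => (16 * ((m + 2 : ℕ) : ℝ) + 32) / c m := by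
    have h1 : Summable fun m : ℕ => (m : ℝ) ^ 1 * (2/3 : ℝ) ^ m :=
      summable_pow_mul_geometric_of_norm_lt_one 1 (by norm_num)
    have h2 : Summable fun m : ℕ => (2/3 : ℝ) ^ m :=
      summable_geometric_of_norm_lt_one (by norm_num)
    refine ((h1.mul_left 16).add (h2.mul_left 64)).congr fun m => ?_
    have : c m = ((2/3 : ℝ) ^ m)⁻¹ := by
      rw [hc, ← inv_pow]; norm_num
    rw [this, div_inv_eq_mul]
    push_cast; ring
  set M := ∑' m : ℕ, (16 * ((m + 2 : ℕ) : ℝ) + 32) / c m with hM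
  have hM0 : 0 ≤ M := tsum_nonneg fun m => by have := hcpos m; positivity
  -- main bound
  have main : ∀ (N : ℕ) (S : XX 𝕜 GQ →L[𝕜] Ms 𝕜 (GQ N)) (δ : ℝ), 0 ≤ δ → (∀ x ∈ K, ‖S x‖ ≤ δ) →
      ∀ n, ‖tH 𝕜 rd S (PG (n + 2))‖ ≤ δ * (1 + M) := by
    intro N S δ hδ hSδ n
    have hpart : ‖tH 𝕜 rd S (PG (n + 2))‖ ≤
        δ * (1 + ∑ m ∈ Finset.range n, (16 * ((m + 2 : ℕ) : ℝ) + 32) / c m) := by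
      induction n with
      | zero =>
        have := hS0 N S δ hδ (fun y hy => hSδ y (Or.inr hy))
        simpa using this
      | succ n ih =>
        have h1 := hS n N S (δ / c n) (div_nonneg hδ (hcpos n).le) (fun y hy => by
          have h2 := hSδ ((c n : 𝕜) • y) (Or.inl (Or.inr (Set.mem_iUnion.2 ⟨n, by
            exact Finset.mem_coe.2 (Finset.mem_image_of_mem _ hy)⟩)))
          rw [map_smul, norm_smul, hnc] at h2
          rw [le_div_iff₀ (hcpos n)]
          linarith)
        rw [map_sub] at h1
        have h3 : ‖tH 𝕜 rd S (PG (n + 1 + 2))‖ ≤ ‖tH 𝕜 rd S (PG (n + 2))‖ +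
            ‖tH 𝕜 rd S (PG (n + 2)) - tH 𝕜 rd S (PG (n + 2 + 1))‖ := by
          have : n + 1 + 2 = n + 2 + 1 := by omega
          rw [this]
          have := norm_sub_le (tH 𝕜 rd S (PG (n + 2))) (tH 𝕜 rd S (PG (n + 2)) - tH 𝕜 rd S (PG (n + 2 + 1)))
          rwa [sub_sub_cancel] at this
        rw [Finset.sum_range_succ]
        refine h3.trans ((add_le_add ih h1).trans (le_of_eq ?_))
        have := (hcpos n).ne'
        field_simp
        ring
    refine hpart.trans ?_
    gcongr
    exact hsum.sum_le_tsum _ fun m _ => by have := hcpos m; positivity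
  -- apply AP
  set ε : ℝ := (2 * (C + 1) * (1 + M))⁻¹ with hε
  have hε0 : 0 < ε := by positivity
  obtain ⟨T, hTfin, hT⟩ := hAP _ hK ε hε0
  obtain ⟨d, φ, w, hφ⟩ := finite_rank_sum T hTfin
  -- lower bound
  have lower : ∀ n, (1/2 : ℝ) ≤ ‖tH 𝕜 rd ((Q (n + 2)).comp (T.comp J)) (PG (n + 2))‖ := by
    intro n
    let S : XX 𝕜 GQ →L[𝕜] Ms 𝕜 (GQ (n + 2)) := (Q (n + 2)).comp (J - T.comp J)
    have h1 := main (n + 2) S (C * ε) (by positivity) (fun x hx => by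
      have h2 := hT (J x) ⟨x, hx, rfl⟩
      change ‖Q (n + 2) (J x - T (J x))‖ ≤ _
      refine ((Q (n + 2)).le_opNorm _).trans ?_
      rw [norm_sub_rev] at h2
      exact mul_le_mul (hQ _) h2.le (norm_nonneg _) hC) n
    have h2 : tH 𝕜 rd ((Q (n + 2)).comp J) (PG (n + 2)) = 1 :=
      tH_ev 𝕜 rd _ (fun x => hQJ _ x) (PP_prob _ _ _ _ _ _ _)
    have h3 : (Q (n + 2)).comp J = S + (Q (n + 2)).comp (T.comp J) := by
      ext1 x
      change Q (n + 2) (J x) = Q (n + 2) (J x - T (J x)) + Q (n + 2) (T (J x))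
      rw [map_sub, sub_add_cancel]
    rw [h3, tH_lin] at h2
    have h4 : C * ε * (1 + M) ≤ 1/2 := by
      rw [hε]
      rw [mul_inv, mul_inv]
      have : C * (2⁻¹ * (C + 1)⁻¹ * (1 + M)⁻¹) * (1 + M) = (C / (C + 1)) * (1/2) := by
        field_simp
      rw [this]
      have : C / (C + 1) ≤ 1 := by rw [div_le_one (by positivity)]; linarith
      linarith
    have h5 : (1:ℝ) ≤ ‖tH 𝕜 rd S (PG (n + 2))‖ + ‖tH 𝕜 rd ((Q (n + 2)).comp (T.comp J)) (PG (n + 2))‖ := by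
      have := norm_add_le (tH 𝕜 rd S (PG (n + 2))) (tH 𝕜 rd ((Q (n + 2)).comp (T.comp J)) (PG (n + 2)))
      rw [h2, norm_one] at this
      exact this
    linarith
  set B := ∑ i, ‖(φ i).comp J‖ * (C * ‖w i‖) with hB
  have upper : ∀ n, ‖tH 𝕜 rd ((Q (n + 2)).comp (T.comp J)) (PG (n + 2))‖ ≤ B * (√((n + 2 : ℕ) : ℝ))⁻¹ := by
    intro n
    have h1 : (Q (n + 2)).comp (T.comp J) = ∑ i, ((φ i).comp J).smulRight (Q (n + 2) (w i)) := by
      ext1 x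
      rw [ContinuousLinearMap.sum_apply]
      change Q (n + 2) (T (J x)) = ∑ i, φ i (J x) • Q (n + 2) (w i)
      rw [hφ, map_sum]
      exact Finset.sum_congr rfl fun i _ => map_smul _ _ _
    rw [h1, tH_sum, hB, Finset.sum_mul]
    refine (norm_sum_le _ _).trans (Finset.sum_le_sum fun i _ => ?_)
    refine (rank_one_est 𝕜 (n + 2) (by omega) _ _).trans ?_
    gcongr
    exact ((Q (n + 2)).le_opNorm _).trans (by gcongr; exact hQ _)
  have lim : Tendsto (fun n : ℕ => B * (√((n + 2 : ℕ) : ℝ))⁻¹) atTop (𝓝 (B * 0)) := by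
    refine Tendsto.const_mul _ (tendsto_inv_atTop_zero.comp ?_)
    refine Real.tendsto_sqrt_atTop.comp ?_
    exact tendsto_natCast_atTop_atTop.comp (tendsto_add_atTop_nat 2)
  have := ge_of_tendsto' lim fun n => (lower n).trans (upper n)
  norm_num at this
end
end SzAP

namespace SzAP

def Om (G : Type) : Type := G → ZMod 2
instance (G : Type) : AddCommGroup (Om G) := inferInstanceAs (AddCommGroup (G → ZMod 2))
instance (G : Type) : Module (ZMod 2) (Om G) := inferInstanceAs (Module (ZMod 2) (G → ZMod 2))
instance (G : Type) [Fintype G] : Fintype (Om G) :=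
  @Pi.instFintype G (fun _ => ZMod 2) (Classical.decEq G) _ _

section
variable (𝕜 : Type*) [RCLike 𝕜] {G : Type} [Fintype G]

lemma sum_exp (a : G → ℝ) : ∑ ω : Om G, Real.exp (∑ i, a i * sg (ω i)) ≤
    Fintype.card (Om G) * Real.exp ((∑ i, a i ^ 2) / 2) := by
  letI : DecidableEq G := Classical.decEq G
  have h1 : ∑ ω : Om G, Real.exp (∑ i, a i * sg (ω i)) =
      ∏ i : G, ∑ t : ZMod 2, Real.exp (a i * sg t) := by
    rw [Fintype.prod_sum]
    refine Finset.sum_congr rfl fun ω _ => ?_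
    rw [Real.exp_sum]
  have h2 : ∀ i, ∑ t : ZMod 2, Real.exp (a i * sg t) ≤ 2 * Real.exp (a i ^ 2 / 2) := by
    intro i
    have h3 := Real.cosh_le_exp_half_sq (a i)
    rw [Real.cosh_eq] at h3
    have : ∑ t : ZMod 2, Real.exp (a i * sg t) = Real.exp (a i * sg 0) + Real.exp (a i * sg 1) :=
      Fin.sum_univ_two (fun t : Fin 2 => Real.exp (a i * sg t))
    rw [this, sg_zero, sg_one, mul_one, mul_neg, mul_one]
    linarith
  rw [h1]
  refine (Finset.prod_le_prod (fun i _ => Finset.sum_nonneg fun t _ => (Real.exp_pos _).le)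
    fun i _ => h2 i).trans (le_of_eq ?_)
  rw [Finset.prod_mul_distrib, Finset.prod_const, Finset.sum_div, Real.exp_sum]
  congr 1
  have : Fintype.card (Om G) = 2 ^ Fintype.card G := by
    have := Fintype.card_fun (α := G) (β := ZMod 2)
    rw [ZMod.card] at this
    exact this
  rw [this, Finset.card_univ]; push_cast; rfl

def rad : Hs 𝕜 G →ₗ[𝕜] (Om G → 𝕜) where
  toFun a ω := ∑ i, a i * ((sg (ω i) : ℝ) : 𝕜)
  map_add' a b := by ext ω; simp [add_mul, Finset.sum_add_distrib]
  map_smul' c a := by ext ω; simp [Finset.mul_sum, mul_assoc]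

lemma rad_apply (a : Hs 𝕜 G) (ω : Om G) : rad 𝕜 a ω = ∑ i, a i * ((sg (ω i) : ℝ) : 𝕜) := rfl

def Kb (s : ℝ) : ℝ := 2 ^ s * (1 + (⌈s⌉₊.factorial : ℝ)) * (4 * Real.exp (1/2))

lemma Kb_pos (s : ℝ) : 0 < Kb s := by unfold Kb; positivity

lemma rpow_le_exp {x s : ℝ} (hx : 0 ≤ x) (hs : 0 ≤ s) :
    x ^ s ≤ (1 + (⌈s⌉₊.factorial : ℝ)) * Real.exp x := by
  have hf : (0:ℝ) < (⌈s⌉₊.factorial : ℝ) := by exact_mod_cast Nat.factorial_pos _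
  have he := Real.one_le_exp hx
  rcases le_total x 1 with h | h
  · have h1 : x ^ s ≤ 1 := Real.rpow_le_one hx h hs
    nlinarith [Real.exp_pos x]
  · have h1 : x ^ s ≤ x ^ (⌈s⌉₊ : ℝ) := Real.rpow_le_rpow_of_exponent_le h (Nat.le_ceil s)
    rw [Real.rpow_natCast] at h1
    have h2 := Real.pow_div_factorial_le_exp x hx ⌈s⌉₊
    rw [div_le_iff₀ hf] at h2
    nlinarith [Real.exp_pos x]

lemma khin_one {s : ℝ} (hs : 0 ≤ s) (a : Hs 𝕜 G) (ha : ‖a‖ ≤ 1) :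
    ∑ ω : Om G, ‖rad 𝕜 a ω‖ ^ s ≤ Fintype.card (Om G) * Kb s := by
  have hsq : ∑ i, ‖a i‖ ^ 2 ≤ 1 := by
    rw [← EuclideanSpace.norm_sq_eq]
    nlinarith [norm_nonneg a]
  have part : ∀ (b : G → ℝ), (∀ i, |b i| ≤ ‖a i‖) → ∑ ω : Om G, Real.exp (∑ i, b i * sg (ω i)) ≤
      Fintype.card (Om G) * Real.exp (1/2) := by
    intro b hb
    refine (sum_exp b).trans ?_
    gcongr
    refine le_trans (Finset.sum_le_sum fun i _ => ?_) hsq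
    exact sq_le_sq' (by have := neg_abs_le (b i); linarith [hb i]) ((le_abs_self _).trans (hb i))
  have p1 := part (fun i => RCLike.re (a i)) fun i => RCLike.abs_re_le_norm _
  have p2 := part (fun i => -RCLike.re (a i)) fun i => by rw [abs_neg]; exact RCLike.abs_re_le_norm _
  have p3 := part (fun i => RCLike.im (a i)) fun i => RCLike.abs_im_le_norm _
  have p4 := part (fun i => -RCLike.im (a i)) fun i => by rw [abs_neg]; exact RCLike.abs_im_le_norm _
  have pt : ∀ ω : Om G, ‖rad 𝕜 a ω‖ ^ s ≤ 2 ^ s * (1 + (⌈s⌉₊.factorial : ℝ)) *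
      (Real.exp (∑ i, RCLike.re (a i) * sg (ω i)) + Real.exp (∑ i, -RCLike.re (a i) * sg (ω i)) +
       Real.exp (∑ i, RCLike.im (a i) * sg (ω i)) + Real.exp (∑ i, -RCLike.im (a i) * sg (ω i))) := by
    intro ω
    set z := rad 𝕜 a ω with hz
    have hre : RCLike.re z = ∑ i, RCLike.re (a i) * sg (ω i) := by
      rw [hz, rad_apply, map_sum]
      refine Finset.sum_congr rfl fun i _ => ?_
      rw [mul_comm, RCLike.re_ofReal_mul, mul_comm]
    have him : RCLike.im z = ∑ i, RCLike.im (a i) * sg (ω i) := by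
      rw [hz, rad_apply, map_sum]
      refine Finset.sum_congr rfl fun i _ => ?_
      rw [mul_comm, RCLike.im_ofReal_mul, mul_comm]
    simp only [neg_mul, Finset.sum_neg_distrib]
    rw [← hre, ← him]
    have hzn : ‖z‖ ≤ |RCLike.re z| + |RCLike.im z| := by
      have := norm_add_le ((RCLike.re z : ℝ) : 𝕜) (((RCLike.im z : ℝ) : 𝕜) * RCLike.I)
      rw [RCLike.re_add_im, norm_mul, RCLike.norm_ofReal, RCLike.norm_ofReal] at this
      have hI : ‖(RCLike.I : 𝕜)‖ ≤ 1 := by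
        by_cases hI0 : (RCLike.I : 𝕜) = 0
        · rw [hI0, norm_zero]; exact zero_le_one
        · rw [RCLike.norm_I_of_ne_zero hI0]
      nlinarith [abs_nonneg (RCLike.im z)]
    have e1 : ‖z‖ ^ s = 2 ^ s * (‖z‖ / 2) ^ s := by
      rw [← Real.mul_rpow (by norm_num) (by positivity)]; congr 1; ring
    have e2 := rpow_le_exp (x := ‖z‖ / 2) (by positivity) hs
    have ab : ∀ t : ℝ, Real.exp |t| ≤ Real.exp t + Real.exp (-t) := by
      intro t
      rcases abs_cases t with ⟨h, _⟩ | ⟨h, _⟩ <;> rw [h] <;>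
        linarith [Real.exp_pos t, Real.exp_pos (-t)]
    have e3 : Real.exp (‖z‖ / 2) ≤ Real.exp |RCLike.re z| + Real.exp |RCLike.im z| := by
      rcases le_total |RCLike.re z| |RCLike.im z| with h | h
      · have : Real.exp (‖z‖ / 2) ≤ Real.exp |RCLike.im z| := Real.exp_le_exp.2 (by linarith)
        linarith [Real.exp_pos |RCLike.re z|]
      · have : Real.exp (‖z‖ / 2) ≤ Real.exp |RCLike.re z| := Real.exp_le_exp.2 (by linarith)
        linarith [Real.exp_pos |RCLike.im z|]
    rw [e1, mul_assoc]
    gcongr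
    refine e2.trans ?_
    gcongr
    linarith [ab (RCLike.re z), ab (RCLike.im z)]
  refine (Finset.sum_le_sum fun ω _ => pt ω).trans ?_
  rw [← Finset.mul_sum, Finset.sum_add_distrib, Finset.sum_add_distrib, Finset.sum_add_distrib]
  calc _ ≤ 2 ^ s * (1 + (⌈s⌉₊.factorial : ℝ)) * (4 * (Fintype.card (Om G) * Real.exp (1/2))) := by
        gcongr; linarith
    _ = _ := by unfold Kb; ring

lemma khin {s : ℝ} (hs : 0 < s) (a : Hs 𝕜 G) :
    ∑ ω : Om G, ‖rad 𝕜 a ω‖ ^ s ≤ Fintype.card (Om G) * Kb s * ‖a‖ ^ s := by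
  by_cases h : a = 0
  · subst h
    simp [Real.zero_rpow hs.ne']
  · have hn : 0 < ‖a‖ := norm_pos_iff.2 h
    have h1 := khin_one 𝕜 hs.le (((‖a‖⁻¹ : ℝ) : 𝕜) • a) (by
      rw [norm_smul, RCLike.norm_ofReal, abs_of_nonneg (by positivity), inv_mul_cancel₀ hn.ne'])
    have h2 : ∀ ω : Om G, ‖rad 𝕜 (((‖a‖⁻¹ : ℝ) : 𝕜) • a) ω‖ ^ s = (‖a‖ ^ s)⁻¹ * ‖rad 𝕜 a ω‖ ^ s := by
      intro ω
      rw [map_smul, Pi.smul_apply, norm_smul, RCLike.norm_ofReal, abs_of_nonneg (by positivity),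
        Real.mul_rpow (by positivity) (by positivity), Real.inv_rpow hn.le]
    simp only [h2] at h1
    rw [← Finset.mul_sum, inv_mul_le_iff₀ (by positivity)] at h1
    linarith

lemma orth (i j : G) [Decidable (i = j)] : ∑ ω : Om G, sg (ω i) * sg (ω j) = if i = j then (Fintype.card (Om G) : ℝ) else 0 := by
  classical
  split_ifs with h
  · subst h
    simp [sg_mul_self]
  · have := sum_char (L := Om G) (AddMonoidHom.mk' (fun ω : Om G => ω i + ω j) (fun x y => by
      change (x i + y i) + (x j + y j) = _; ring)) (w := (Pi.single i 1 : G → ZMod 2)) (by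
      change (Pi.single i 1 : G → ZMod 2) i + (Pi.single i 1 : G → ZMod 2) j = 1
      rw [Pi.single_eq_same, Pi.single_eq_of_ne (Ne.symm h), add_zero])
    simp only [← sg_add]
    exact this

def anl : (Om G → 𝕜) →ₗ[𝕜] Hs 𝕜 G where
  toFun f := WithLp.toLp 2 fun i => ∑ ω, f ω * ((sg (ω i) : ℝ) : 𝕜)
  map_add' a b := by ext ω; simp [add_mul, Finset.sum_add_distrib]
  map_smul' c a := by ext ω; simp [Finset.mul_sum, mul_assoc]

lemma anl_apply (f : Om G → 𝕜) (i : G) : anl 𝕜 f i = ∑ ω, f ω * ((sg (ω i) : ℝ) : 𝕜) := rfl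

lemma anl_rad (a : Hs 𝕜 G) : anl 𝕜 (rad 𝕜 a) = (Fintype.card (Om G) : 𝕜) • a := by
  classical
  ext i
  rw [anl_apply]
  simp only [rad_apply, Finset.sum_mul]
  rw [Finset.sum_comm]
  have : ∀ j, ∑ ω : Om G, a j * ((sg (ω j) : ℝ) : 𝕜) * ((sg (ω i) : ℝ) : 𝕜) =
      a j * (((if j = i then (Fintype.card (Om G) : ℝ) else 0) : ℝ) : 𝕜) := by
    intro j
    rw [← orth, RCLike.ofReal_sum, Finset.mul_sum]
    refine Finset.sum_congr rfl fun ω _ => ?_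
    push_cast; ring
  simp only [this]
  rw [Finset.sum_eq_single i]
  · simp [mul_comm]
  · intro j _ hj; simp [hj]
  · simp

/-- dual bound -/
lemma norm_anl {s s' : ℝ} (h : s.HolderConjugate s') (f : Om G → 𝕜) :
    ‖anl 𝕜 f‖ ≤ (∑ ω, ‖f ω‖ ^ s) ^ (1 / s) * (Fintype.card (Om G) * Kb s') ^ (1 / s') := by
  set b := anl 𝕜 f with hb
  by_cases hb0 : ‖b‖ = 0
  · rw [hb0]
    have := Kb_pos s'
    positivity
  have hbpos : 0 < ‖b‖ := lt_of_le_of_ne (norm_nonneg _) (Ne.symm hb0)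
  let b' : Hs 𝕜 G := WithLp.toLp 2 fun i => star (b i)
  have hb'n : ‖b'‖ = ‖b‖ := by
    rw [EuclideanSpace.norm_eq, EuclideanSpace.norm_eq]
    simp [b']
  have h1 : ((‖b‖ ^ 2 : ℝ) : 𝕜) = ∑ ω, f ω * rad 𝕜 b' ω := by
    rw [EuclideanSpace.norm_sq_eq, RCLike.ofReal_sum]
    have : ∀ i, ((‖b i‖ ^ 2 : ℝ) : 𝕜) = ∑ ω, f ω * (star (b i) * ((sg (ω i) : ℝ) : 𝕜)) := by
      intro i
      have h2 : ((‖b i‖ ^ 2 : ℝ) : 𝕜) = star (b i) * b i := by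
        rw [RCLike.star_def, RCLike.conj_mul]; push_cast; rfl
      rw [h2]
      nth_rewrite 2 [hb]
      rw [anl_apply, Finset.mul_sum]
      exact Finset.sum_congr rfl fun ω _ => by ring
    simp only [this]
    rw [Finset.sum_comm]
    refine Finset.sum_congr rfl fun ω _ => ?_
    rw [rad_apply, Finset.mul_sum]
  have h2 : ‖b‖ ^ 2 ≤ ∑ ω, ‖f ω‖ * ‖rad 𝕜 b' ω‖ := by
    have h3 := congrArg norm h1
    rw [RCLike.norm_ofReal, abs_of_nonneg (by positivity)] at h3
    rw [h3]
    refine (norm_sum_le _ _).trans (le_of_eq (Finset.sum_congr rfl fun ω _ => norm_mul _ _))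
  have h3 := Real.inner_le_Lp_mul_Lq_of_nonneg Finset.univ (f := fun ω : Om G => ‖f ω‖)
    (g := fun ω => ‖rad 𝕜 b' ω‖) h (fun _ _ => norm_nonneg _) (fun _ _ => norm_nonneg _)
  have h4 : (∑ ω : Om G, ‖rad 𝕜 b' ω‖ ^ s') ^ (1 / s') ≤
      (Fintype.card (Om G) * Kb s') ^ (1 / s') * ‖b‖ := by
    have hs' := h.symm.pos
    have h5 := khin 𝕜 hs' b'
    have hk := Kb_pos s'
    calc _ ≤ (Fintype.card (Om G) * Kb s' * ‖b'‖ ^ s') ^ (1 / s') := by gcongr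
      _ = _ := by
        rw [Real.mul_rpow (by positivity) (by positivity), ← Real.rpow_mul (norm_nonneg _),
          mul_one_div_cancel hs'.ne', Real.rpow_one, hb'n]
  have h6 : ‖b‖ * ‖b‖ ≤ ((∑ ω, ‖f ω‖ ^ s) ^ (1 / s) * (Fintype.card (Om G) * Kb s') ^ (1 / s')) * ‖b‖ := by
    rw [← sq, mul_assoc]
    refine h2.trans (h3.trans ?_)
    gcongr
  exact le_of_mul_le_mul_right h6 hbpos

end
end SzAP

namespace SzAP

section
variable (𝕜 : Type*) [RCLike 𝕜]

structure Blk (G : ℕ → Type) [∀ N, Fintype (G N)] (s : ℝ) where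
  K : ℝ
  hK : 0 ≤ K
  syn : ∀ N, Hs 𝕜 (G N) →ₗ[𝕜] (Om (G N) → 𝕜)
  ana : ∀ N, (Om (G N) → 𝕜) →ₗ[𝕜] Hs 𝕜 (G N)
  inv : ∀ N a, ana N (syn N a) = a
  hsyn : ∀ N a, ∑ ω, ‖syn N a ω‖ ^ s ≤ K ^ s * ‖a‖ ^ s
  hana : ∀ N f, ‖ana N f‖ ^ s ≤ K ^ s * ∑ ω, ‖f ω‖ ^ s

lemma exists_blk (G : ℕ → Type) [∀ N, Fintype (G N)] (s : ℝ) (hs : 1 < s) :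
    Nonempty (Blk 𝕜 G s) := by
  obtain ⟨s', h⟩ : ∃ s', s.HolderConjugate s' := ⟨_, Real.HolderConjugate.conjExponent hs⟩
  have hs0 := h.pos
  have hs'0 := h.symm.pos
  have hk := Kb_pos s
  have hk' := Kb_pos s'
  set K1 := Kb s ^ (1 / s) with hK1
  set K2 := Kb s' ^ (1 / s') with hK2
  have hK10 : 0 ≤ K1 := by positivity
  have hK20 : 0 ≤ K2 := by positivity
  have hM : ∀ N, (0:ℝ) < Fintype.card (Om (G N)) := fun N => by
    exact_mod_cast Fintype.card_pos
  refine ⟨⟨max K1 K2, le_max_of_le_left hK10,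
    fun N => ((((Fintype.card (Om (G N)) : ℝ) ^ (-(1 / s)) : ℝ)) : 𝕜) • rad 𝕜,
    fun N => ((((Fintype.card (Om (G N)) : ℝ) ^ (-(1 / s')) : ℝ)) : 𝕜) • anl 𝕜, ?_, ?_, ?_⟩⟩
  · intro N a
    rw [LinearMap.smul_apply, LinearMap.smul_apply, map_smul, anl_rad, smul_smul, smul_smul]
    have : (((Fintype.card (Om (G N)) : ℝ) ^ (-(1 / s')) : ℝ) : 𝕜) *
        (((Fintype.card (Om (G N)) : ℝ) ^ (-(1 / s)) : ℝ) : 𝕜) * (Fintype.card (Om (G N)) : 𝕜) = 1 := by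
      have h1 : (Fintype.card (Om (G N)) : 𝕜) = ((Fintype.card (Om (G N)) : ℝ) : 𝕜) := by simp
      rw [h1, ← RCLike.ofReal_mul, ← RCLike.ofReal_mul, ← Real.rpow_add (hM N)]
      have h2 : -(1 / s') + -(1 / s) = -1 := by
        have := h.inv_add_inv_eq_one
        simp only [one_div]; linarith
      rw [h2, Real.rpow_neg_one, inv_mul_cancel₀ (hM N).ne', RCLike.ofReal_one]
    rw [this, one_smul]
  · intro N a
    have h1 := khin 𝕜 hs0 a
    have h2 : ∀ ω, ‖(((((Fintype.card (Om (G N)) : ℝ) ^ (-(1 / s)) : ℝ)) : 𝕜) • rad 𝕜) a ω‖ ^ s =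
        (Fintype.card (Om (G N)) : ℝ)⁻¹ * ‖rad 𝕜 a ω‖ ^ s := by
      intro ω
      have := hM N
      rw [LinearMap.smul_apply, Pi.smul_apply, norm_smul, RCLike.norm_ofReal,
        abs_of_nonneg (by positivity), Real.mul_rpow (by positivity) (by positivity),
        ← Real.rpow_mul this.le]
      have h3 : -(1 / s) * s = -1 := by field_simp
      rw [h3, Real.rpow_neg_one]
    simp only [h2]
    rw [← Finset.mul_sum, inv_mul_le_iff₀ (hM N), ← mul_assoc]
    refine h1.trans ?_
    have h4 : Kb s ≤ max K1 K2 ^ s := by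
      calc Kb s = K1 ^ s := by
            rw [hK1, ← Real.rpow_mul hk.le, one_div_mul_cancel hs0.ne', Real.rpow_one]
        _ ≤ _ := by gcongr; exact le_max_left _ _
    gcongr
  · intro N f
    have hMN := hM N
    have h1 := norm_anl 𝕜 h f
    have hsum : 0 ≤ ∑ ω, ‖f ω‖ ^ s := Finset.sum_nonneg fun _ _ => by positivity
    rw [LinearMap.smul_apply, norm_smul, RCLike.norm_ofReal, abs_of_nonneg (by positivity)]
    have h2 : (Fintype.card (Om (G N)) : ℝ) ^ (-(1 / s')) * ‖anl 𝕜 f‖ ≤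
        max K1 K2 * (∑ ω, ‖f ω‖ ^ s) ^ (1 / s) := by
      calc _ ≤ (Fintype.card (Om (G N)) : ℝ) ^ (-(1 / s')) * ((∑ ω, ‖f ω‖ ^ s) ^ (1 / s) *
            (Fintype.card (Om (G N)) * Kb s') ^ (1 / s')) := by gcongr
        _ = K2 * (∑ ω, ‖f ω‖ ^ s) ^ (1 / s) := by
          rw [Real.mul_rpow hMN.le hk'.le, Real.rpow_neg hMN.le]
          have : (Fintype.card (Om (G N)) : ℝ) ^ (1 / s') ≠ 0 := by positivity
          rw [← hK2]
          field_simp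
        _ ≤ _ := by gcongr; exact le_max_right _ _
    calc _ ≤ (max K1 K2 * (∑ ω, ‖f ω‖ ^ s) ^ (1 / s)) ^ s := by gcongr
      _ = _ := by
        rw [Real.mul_rpow (le_max_of_le_left hK10) (by positivity), ← Real.rpow_mul hsum,
          one_div_mul_cancel hs0.ne', Real.rpow_one]

variable {𝕜} {G : ℕ → Type} [∀ N, Fintype (G N)] (σ : (Σ N, Om (G N)) ≃ ℕ)

lemma sum_blocks (h : ℕ → ℝ) (h0 : ∀ k, 0 ≤ h k) (t : Finset ℕ) :
    ∃ n, ∑ k ∈ t, h k ≤ ∑ N ∈ Finset.range n, ∑ ω, h (σ ⟨N, ω⟩) := by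
  classical
  refine ⟨t.sup (fun k => (σ.symm k).1) + 1, ?_⟩
  have h1 := Finset.sum_sigma (Finset.range (t.sup (fun k => (σ.symm k).1) + 1))
    (fun N => (Finset.univ : Finset (Om (G N)))) (fun x => h (σ x))
  have h2 : ∑ x ∈ (Finset.range (t.sup (fun k => (σ.symm k).1) + 1)).sigma
      (fun N => (Finset.univ : Finset (Om (G N)))), h (σ x) = _ :=
    (Finset.sum_map _ σ.toEmbedding h).symm
  rw [← h1, h2]
  refine Finset.sum_le_sum_of_subset_of_nonneg ?_ fun _ _ _ => h0 _
  intro k hk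
  rw [Finset.mem_map_equiv, Finset.mem_sigma]
  refine ⟨?_, Finset.mem_univ _⟩
  rw [Finset.mem_range, Nat.lt_succ_iff]
  exact Finset.le_sup (f := fun k => (σ.symm k).1) hk

lemma blocks_sum (h : ℕ → ℝ) (n : ℕ) :
    ∃ t : Finset ℕ, ∑ N ∈ Finset.range n, ∑ ω, h (σ ⟨N, ω⟩) = ∑ k ∈ t, h k := by
  classical
  refine ⟨((Finset.range n).sigma (fun N => (Finset.univ : Finset (Om (G N))))).map σ.toEmbedding, ?_⟩
  rw [Finset.sum_map, Finset.sum_sigma]; rfl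

/-- glueing -/
def gl {s : ℝ} (B : Blk 𝕜 G s) (b : ∀ N, Hs 𝕜 (G N)) (k : ℕ) : 𝕜 :=
  B.syn (σ.symm k).1 (b _) (σ.symm k).2

lemma gl_apply {s : ℝ} (B : Blk 𝕜 G s) (b : ∀ N, Hs 𝕜 (G N)) (N : ℕ) (ω : Om (G N)) :
    gl σ B b (σ ⟨N, ω⟩) = B.syn N (b N) ω := by
  unfold gl
  rw [Equiv.symm_apply_apply]

lemma gl_bound {s : ℝ} (hs : 0 < s) (B : Blk 𝕜 G s) (b : ∀ N, Hs 𝕜 (G N)) (C : ℝ) (hC : 0 ≤ C)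
    (hb : ∀ n, ∑ N ∈ Finset.range n, ‖b N‖ ^ s ≤ C ^ s) (t : Finset ℕ) :
    ∑ k ∈ t, ‖gl σ B b k‖ ^ s ≤ (B.K * C) ^ s := by
  obtain ⟨n, hn⟩ := sum_blocks σ (fun k => ‖gl σ B b k‖ ^ s) (fun k => by positivity) t
  refine hn.trans ?_
  have hK := B.hK
  simp only [gl_apply]
  calc _ ≤ ∑ N ∈ Finset.range n, B.K ^ s * ‖b N‖ ^ s := Finset.sum_le_sum fun N _ => B.hsyn N _
    _ ≤ B.K ^ s * C ^ s := by rw [← Finset.mul_sum]; gcongr; exact hb n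
    _ = _ := by rw [Real.mul_rpow hK hC]

abbrev ll (𝕜 : Type*) [RCLike 𝕜] (s : ℝ≥0∞) := lp (fun _ : ℕ => 𝕜) s

def glue {s : ℝ≥0∞} (hs : 0 < s.toReal) (B : Blk 𝕜 G s.toReal) (b : ∀ N, Hs 𝕜 (G N)) (C : ℝ) (hC : 0 ≤ C)
    (hb : ∀ n, ∑ N ∈ Finset.range n, ‖b N‖ ^ s.toReal ≤ C ^ s.toReal) : ll 𝕜 s :=
  ⟨gl σ B b, memℓp_gen' (gl_bound σ hs B b C hC hb)⟩

lemma glue_apply {s : ℝ≥0∞} (hs : 0 < s.toReal) (B : Blk 𝕜 G s.toReal) (b : ∀ N, Hs 𝕜 (G N)) (C : ℝ) (hC : 0 ≤ C)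
    (hb) (k : ℕ) : (glue σ hs B b C hC hb : ll 𝕜 s) k = gl σ B b k := rfl

lemma norm_glue {s : ℝ≥0∞} (hs : 0 < s.toReal) (B : Blk 𝕜 G s.toReal) (b : ∀ N, Hs 𝕜 (G N)) (C : ℝ) (hC : 0 ≤ C)
    (hb) : ‖(glue σ hs B b C hC hb : ll 𝕜 s)‖ ≤ B.K * C :=
  lp.norm_le_of_forall_sum_le hs (mul_nonneg B.hK hC) (gl_bound σ hs B b C hC hb)

/-- analysis -/
def anN {s : ℝ≥0∞} (B : Blk 𝕜 G s.toReal) (N : ℕ) : ll 𝕜 s →ₗ[𝕜] Hs 𝕜 (G N) :=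
  (B.ana N).comp
    ({ toFun := fun f ω => f (σ ⟨N, ω⟩)
       map_add' := fun f g => rfl
       map_smul' := fun c f => rfl } : ll 𝕜 s →ₗ[𝕜] (Om (G N) → 𝕜))

lemma anN_apply {s : ℝ≥0∞} (B : Blk 𝕜 G s.toReal) (N : ℕ) (f : ll 𝕜 s) :
    anN σ B N f = B.ana N (fun ω => f (σ ⟨N, ω⟩)) := rfl

lemma anN_glue {s : ℝ≥0∞} (hs : 0 < s.toReal) (B : Blk 𝕜 G s.toReal) (b : ∀ N, Hs 𝕜 (G N)) (C : ℝ) (hC : 0 ≤ C)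
    (hb) (N : ℕ) : anN σ B N (glue σ hs B b C hC hb : ll 𝕜 s) = b N := by
  rw [anN_apply]
  have : (fun ω => (glue σ hs B b C hC hb : ll 𝕜 s) (σ ⟨N, ω⟩)) = B.syn N (b N) := by
    ext ω; rw [glue_apply, gl_apply]
  rw [this, B.inv]

lemma sum_anN {s : ℝ≥0∞} (hs : 0 < s.toReal) (B : Blk 𝕜 G s.toReal) (f : ll 𝕜 s) (n : ℕ) :
    ∑ N ∈ Finset.range n, ‖anN σ B N f‖ ^ s.toReal ≤ (B.K * ‖f‖) ^ s.toReal := by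
  obtain ⟨t, ht⟩ := blocks_sum σ (fun k => ‖f k‖ ^ s.toReal) n
  have hK := B.hK
  calc _ ≤ ∑ N ∈ Finset.range n, B.K ^ s.toReal * ∑ ω, ‖f (σ ⟨N, ω⟩)‖ ^ s.toReal :=
        Finset.sum_le_sum fun N _ => B.hana N _
    _ ≤ B.K ^ s.toReal * ‖f‖ ^ s.toReal := by
      rw [← Finset.mul_sum, ht]
      gcongr
      exact lp.sum_rpow_le_norm_rpow hs f t
    _ = _ := by rw [Real.mul_rpow hK (lp.norm_nonneg' f)]

lemma norm_anN {s : ℝ≥0∞} (hs : 0 < s.toReal) (B : Blk 𝕜 G s.toReal) (f : ll 𝕜 s) (N : ℕ) :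
    ‖anN σ B N f‖ ≤ B.K * ‖f‖ := by
  have h1 := sum_anN σ hs B f (N + 1)
  have h2 : ‖anN σ B N f‖ ^ s.toReal ≤ ∑ N ∈ Finset.range (N + 1), ‖anN σ B N f‖ ^ s.toReal :=
    Finset.single_le_sum (f := fun N => ‖anN σ B N f‖ ^ s.toReal) (fun _ _ => by positivity) (Finset.self_mem_range_succ N)
  exact (Real.rpow_le_rpow_iff (norm_nonneg _) (mul_nonneg B.hK (lp.norm_nonneg' f)) hs).1 (h2.trans h1)

lemma single_bound {s : ℝ} (hs : 0 < s) (N : ℕ) (a : Hs 𝕜 (G N)) (n : ℕ) :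
    ∑ M ∈ Finset.range n, ‖(Pi.single N a : ∀ M, Hs 𝕜 (G M)) M‖ ^ s ≤ ‖a‖ ^ s := by
  classical
  by_cases h : N ∈ Finset.range n
  · rw [Finset.sum_eq_single_of_mem N h]
    · rw [Pi.single_eq_same]
    · intro M _ hM
      rw [Pi.single_eq_of_ne hM, norm_zero, Real.zero_rpow hs.ne']
  · rw [Finset.sum_eq_zero]
    · positivity
    · intro M hM
      rw [Pi.single_eq_of_ne (fun e : M = N => h (by rw [← e]; exact hM)), norm_zero, Real.zero_rpow hs.ne']

variable {s : ℝ≥0∞} [Fact (1 ≤ s)]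

def inc (hs : 0 < s.toReal) (B : Blk 𝕜 G s.toReal) (N : ℕ) : Hs 𝕜 (G N) →L[𝕜] ll 𝕜 s :=
  LinearMap.mkContinuous
    { toFun := fun a => glue σ hs B (Pi.single N a) ‖a‖ (norm_nonneg _) (single_bound hs N a)
      map_add' := fun a b => by
        apply lp.ext; funext k
        change gl σ B _ k = gl σ B _ k + gl σ B _ k
        unfold gl
        rw [Pi.single_add, Pi.add_apply, map_add]; rfl
      map_smul' := fun c a => by
        apply lp.ext; funext k
        change gl σ B _ k = c • gl σ B _ k
        unfold gl
        rw [Pi.single_smul, Pi.smul_apply, map_smul]; rfl } B.K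
    (fun a => norm_glue σ hs B (Pi.single N a) ‖a‖ (norm_nonneg _) (single_bound hs N a))

lemma norm_inc (hs : 0 < s.toReal) (B : Blk 𝕜 G s.toReal) (N : ℕ) : ‖inc σ hs B N‖ ≤ B.K :=
  LinearMap.mkContinuous_norm_le _ B.hK _

def anC (hs : 0 < s.toReal) (B : Blk 𝕜 G s.toReal) (N : ℕ) : ll 𝕜 s →L[𝕜] Hs 𝕜 (G N) :=
  (anN σ B N).mkContinuous B.K (fun f => norm_anN σ hs B f N)

lemma norm_anC (hs : 0 < s.toReal) (B : Blk 𝕜 G s.toReal) (N : ℕ) : ‖anC σ hs B N‖ ≤ B.K :=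
  LinearMap.mkContinuous_norm_le _ B.hK _

lemma anN_inc (hs : 0 < s.toReal) (B : Blk 𝕜 G s.toReal) (N : ℕ) (a : Hs 𝕜 (G N)) :
    anN σ B N (inc σ hs B N a) = a := by
  have := anN_glue σ hs B (Pi.single N a) ‖a‖ (norm_nonneg _) (single_bound hs N a) N
  rw [Pi.single_eq_same] at this
  exact this

end
end SzAP

namespace SzAP

section
variable {𝕜 : Type*} [RCLike 𝕜] {G : ℕ → Type} [∀ N, Fintype (G N)] [∀ N, Group (G N)]
  (σ : (Σ N, Om (G N)) ≃ ℕ)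
  {p q : ℝ≥0∞} [Fact (1 ≤ p)] [Fact (1 ≤ q)] (hp : 0 < p.toReal) (hq : 0 < q.toReal)
  (hpq : p.toReal ≤ q.toReal) (Bp : Blk 𝕜 G p.toReal) (Bq : Blk 𝕜 G q.toReal)

lemma rpow_aux {a b t T : ℝ} (ha : 0 < a) (hab : a ≤ b) (ht : 0 ≤ t) (htT : t ≤ T) :
    t ^ b ≤ T ^ (b - a) * t ^ a := by
  have h1 : t ^ b = t ^ (b - a) * t ^ a := by
    rw [← Real.rpow_add_of_nonneg ht (by linarith) ha.le]; congr 1; ring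
  rw [h1]
  have := Real.rpow_le_rpow ht htT (sub_nonneg.2 hab)
  gcongr

include hp hpq in
lemma J0_bound (x : XX 𝕜 G) (f : ll 𝕜 p) (n : ℕ) :
    ∑ N ∈ Finset.range n, ‖ev 𝕜 N x (anN σ Bp N f)‖ ^ q.toReal ≤
      (‖x‖ * (Bp.K * ‖f‖)) ^ q.toReal := by
  have hT : 0 ≤ Bp.K * ‖f‖ := mul_nonneg Bp.hK (norm_nonneg _)
  have hq : 0 < q.toReal := hp.trans_le hpq
  have hx : 0 ≤ ‖x‖ := norm_nonneg x
  calc _ ≤ ∑ N ∈ Finset.range n, ‖x‖ ^ q.toReal *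
        ((Bp.K * ‖f‖) ^ (q.toReal - p.toReal) * ‖anN σ Bp N f‖ ^ p.toReal) := by
        refine Finset.sum_le_sum fun N _ => ?_
        have h1 : ‖ev 𝕜 N x (anN σ Bp N f)‖ ≤ ‖x‖ * ‖anN σ Bp N f‖ :=
          ((ev 𝕜 N x).le_opNorm _).trans
            (mul_le_mul_of_nonneg_right (XX.norm_ev_le 𝕜 x N) (norm_nonneg _))
        refine (Real.rpow_le_rpow (norm_nonneg _) h1 hq.le).trans ?_
        rw [Real.mul_rpow hx (norm_nonneg _)]
        exact mul_le_mul_of_nonneg_left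
          (rpow_aux hp hpq (norm_nonneg _) (norm_anN σ hp Bp f N)) (Real.rpow_nonneg hx _)
    _ = ‖x‖ ^ q.toReal * ((Bp.K * ‖f‖) ^ (q.toReal - p.toReal) *
        ∑ N ∈ Finset.range n, ‖anN σ Bp N f‖ ^ p.toReal) := by
        rw [Finset.mul_sum, Finset.mul_sum]
    _ ≤ ‖x‖ ^ q.toReal * ((Bp.K * ‖f‖) ^ (q.toReal - p.toReal) * (Bp.K * ‖f‖) ^ p.toReal) := by
        have := sum_anN σ hp Bp f n
        exact mul_le_mul_of_nonneg_left (mul_le_mul_of_nonneg_left this (Real.rpow_nonneg hT _))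
          (Real.rpow_nonneg hx _)
    _ = _ := by
        rw [← Real.rpow_add_of_nonneg hT (by linarith) hp.le, Real.mul_rpow hx hT, sub_add_cancel]

def J1 (x : XX 𝕜 G) (f : ll 𝕜 p) : ll 𝕜 q :=
  glue σ hq Bq (fun N => ev 𝕜 N x (anN σ Bp N f)) (‖x‖ * (Bp.K * ‖f‖))
    (mul_nonneg (norm_nonneg x) (mul_nonneg Bp.hK (norm_nonneg f))) (J0_bound σ hp hpq Bp x f)

lemma J1_apply (x : XX 𝕜 G) (f : ll 𝕜 p) (k : ℕ) :
    J1 σ hp hq hpq Bp Bq x f k = gl σ Bq (fun N => ev 𝕜 N x (anN σ Bp N f)) k := rfl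

def J0 : XX 𝕜 G →L[𝕜] (ll 𝕜 p →L[𝕜] ll 𝕜 q) :=
  LinearMap.mkContinuous₂ (LinearMap.mk₂ 𝕜 (J1 σ hp hq hpq Bp Bq)
    (fun x y f => by
      apply lp.ext; funext k
      rw [lp.coeFn_add, Pi.add_apply, J1_apply, J1_apply, J1_apply]
      simp only [gl, map_add, ContinuousLinearMap.add_apply, Pi.add_apply])
    (fun c x f => by
      apply lp.ext; funext k
      rw [lp.coeFn_smul, Pi.smul_apply, J1_apply, J1_apply]
      simp only [gl, map_smul, ContinuousLinearMap.smul_apply, Pi.smul_apply])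
    (fun x f g => by
      apply lp.ext; funext k
      rw [lp.coeFn_add, Pi.add_apply, J1_apply, J1_apply, J1_apply]
      simp only [gl, map_add, Pi.add_apply])
    (fun c x f => by
      apply lp.ext; funext k
      rw [lp.coeFn_smul, Pi.smul_apply, J1_apply, J1_apply]
      simp only [gl, map_smul, Pi.smul_apply])) (Bq.K * Bp.K)
    (fun x f => by
      refine (norm_glue σ hq Bq (fun N => ev 𝕜 N x (anN σ Bp N f)) (‖x‖ * (Bp.K * ‖f‖))
        (mul_nonneg (norm_nonneg x) (mul_nonneg Bp.hK (norm_nonneg f)))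
        (J0_bound σ hp hpq Bp x f)).trans (le_of_eq ?_)
      ring)

lemma anN_J0 (x : XX 𝕜 G) (f : ll 𝕜 p) (N : ℕ) :
    anN σ Bq N (J0 σ hp hq hpq Bp Bq x f) = ev 𝕜 N x (anN σ Bp N f) :=
  anN_glue σ hq Bq (fun N => ev 𝕜 N x (anN σ Bp N f)) (‖x‖ * (Bp.K * ‖f‖))
    (mul_nonneg (norm_nonneg x) (mul_nonneg Bp.hK (norm_nonneg f))) (J0_bound σ hp hpq Bp x f) N

end

lemma exists_sigma : Nonempty ((Σ N, Om (GQ N)) ≃ ℕ) := by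
  have : ∀ N, Finite (Om (GQ N)) := fun N => inferInstance
  have : Countable (Σ N, Om (GQ N)) := inferInstance
  have : Infinite (Σ N, Om (GQ N)) :=
    Infinite.of_injective (fun N : ℕ => (⟨N, 0⟩ : Σ N, Om (GQ N))) (fun a b h => congrArg Sigma.fst h)
  exact nonempty_equiv_of_countable

theorem final {𝕜 : Type*} [RCLike 𝕜] {p q : ℝ≥0∞} [Fact (1 ≤ p)] [Fact (1 ≤ q)]
    (hp : 1 < p) (hpq : p ≤ q) (hq : q < ⊤)
    {E F : Type*} [NormedAddCommGroup E] [NormedSpace 𝕜 E]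
    [NormedAddCommGroup F] [NormedSpace 𝕜 F]
    (AE : ll 𝕜 p →L[𝕜] E) (BE : E →L[𝕜] ll 𝕜 p) (hE : ∀ x, BE (AE x) = x)
    (AF : ll 𝕜 q →L[𝕜] F) (BF : F →L[𝕜] ll 𝕜 q) (hF : ∀ x, BF (AF x) = x) :
    ¬ HasAP 𝕜 (E →L[𝕜] F) := by
  obtain ⟨σ⟩ := exists_sigma
  have hp1 : 1 < p.toReal := by
    rw [← ENNReal.toReal_one]
    exact (ENNReal.toReal_lt_toReal ENNReal.one_ne_top (hpq.trans_lt hq).ne).2 hp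
  have hpq' : p.toReal ≤ q.toReal := ENNReal.toReal_mono hq.ne hpq
  have hq1 : 1 < q.toReal := hp1.trans_le hpq'
  have hp0 : 0 < p.toReal := by linarith
  have hq0 : 0 < q.toReal := by linarith
  obtain ⟨Bp⟩ := exists_blk 𝕜 GQ p.toReal hp1
  obtain ⟨Bq⟩ := exists_blk 𝕜 GQ q.toReal hq1
  let R : (ll 𝕜 p →L[𝕜] ll 𝕜 q) →L[𝕜] (E →L[𝕜] F) := LinearMap.mkContinuous
    ({ toFun := fun w => AF.comp (w.comp BE)
       map_add' := fun a b => by ext x; simp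
       map_smul' := fun c a => by ext x; simp } : (ll 𝕜 p →L[𝕜] ll 𝕜 q) →ₗ[𝕜] (E →L[𝕜] F))
    (‖AF‖ * ‖BE‖) (fun w => by
      have h1 := AF.opNorm_comp_le (w.comp BE)
      have h2 := w.opNorm_comp_le BE
      have h3 := mul_le_mul_of_nonneg_left h2 (ContinuousLinearMap.opNorm_nonneg AF)
      refine h1.trans (h3.trans (le_of_eq ?_))
      ring)
  let Q : ∀ N, (E →L[𝕜] F) →L[𝕜] Ms 𝕜 (GQ N) := fun N => LinearMap.mkContinuous
    ({ toFun := fun w => ((anC σ hq0 Bq N).comp BF).comp (w.comp (AE.comp (inc σ hp0 Bp N)))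
       map_add' := fun a b => by ext x; simp
       map_smul' := fun c a => by ext x; simp } : (E →L[𝕜] F) →ₗ[𝕜] Ms 𝕜 (GQ N))
    ((Bq.K * ‖BF‖) * (‖AE‖ * Bp.K)) (fun w => by
      have h1 := ((anC σ hq0 Bq N).comp BF).opNorm_comp_le (w.comp (AE.comp (inc σ hp0 Bp N)))
      have h2 : ‖(anC σ hq0 Bq N).comp BF‖ ≤ Bq.K * ‖BF‖ :=
        ((anC σ hq0 Bq N).opNorm_comp_le BF).trans
          (mul_le_mul_of_nonneg_right (norm_anC σ hq0 Bq N) (ContinuousLinearMap.opNorm_nonneg BF))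
      have h3 : ‖AE.comp (inc σ hp0 Bp N)‖ ≤ ‖AE‖ * Bp.K :=
        (AE.opNorm_comp_le (inc σ hp0 Bp N)).trans
          (mul_le_mul_of_nonneg_left (norm_inc σ hp0 Bp N) (ContinuousLinearMap.opNorm_nonneg AE))
      have h4 : ‖w.comp (AE.comp (inc σ hp0 Bp N))‖ ≤ ‖w‖ * (‖AE‖ * Bp.K) :=
        (w.opNorm_comp_le _).trans
          (mul_le_mul_of_nonneg_left h3 (ContinuousLinearMap.opNorm_nonneg w))
      refine h1.trans ((mul_le_mul h2 h4 (ContinuousLinearMap.opNorm_nonneg _)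
        (mul_nonneg Bq.hK (ContinuousLinearMap.opNorm_nonneg BF))).trans (le_of_eq ?_))
      ring)
  refine no_ap (R.comp (J0 σ hp0 hq0 hpq' Bp Bq)) Q ((Bq.K * ‖BF‖) * (‖AE‖ * Bp.K)) ?_ ?_
  · intro N
    exact LinearMap.mkContinuous_norm_le _ (mul_nonneg (mul_nonneg Bq.hK (ContinuousLinearMap.opNorm_nonneg BF))
      (mul_nonneg (ContinuousLinearMap.opNorm_nonneg AE) Bp.hK)) _
  · intro N x
    refine ContinuousLinearMap.ext fun a => ?_
    change anN σ Bq N (BF (AF (J0 σ hp0 hq0 hpq' Bp Bq x (BE (AE (inc σ hp0 Bp N a)))))) = _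
    rw [hF, hE, anN_J0, anN_inc]

end SzAP

/-- If `1 < p ≤ q < ∞` and `E`, `F` contain complemented subspaces isomorphic to `ℓ_p` and
`ℓ_q` respectively, then `L(E;F)` fails the approximation property. -/
theorem not_ap_opSpace (𝕜 : Type*) [RCLike 𝕜] (p q : ℝ≥0∞) [Fact (1 ≤ p)] [Fact (1 ≤ q)]
    (hp : 1 < p) (hpq : p ≤ q) (hq : q < ⊤)
    (E F : Type*) [NormedAddCommGroup E] [NormedSpace 𝕜 E] [CompleteSpace E]
    [NormedAddCommGroup F] [NormedSpace 𝕜 F] [CompleteSpace F]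
    (hE : ∃ (A : lp (fun _ : ℕ => 𝕜) p →L[𝕜] E) (B : E →L[𝕜] lp (fun _ : ℕ => 𝕜) p),
      B.comp A = ContinuousLinearMap.id 𝕜 (lp (fun _ : ℕ => 𝕜) p))
    (hF : ∃ (A : lp (fun _ : ℕ => 𝕜) q →L[𝕜] F) (B : F →L[𝕜] lp (fun _ : ℕ => 𝕜) q),
      B.comp A = ContinuousLinearMap.id 𝕜 (lp (fun _ : ℕ => 𝕜) q)) :
    ¬ HasAP 𝕜 (E →L[𝕜] F) := by
  obtain ⟨AE, BE, hE⟩ := hE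
  obtain ⟨AF, BF, hF⟩ := hF
  exact SzAP.final hp hpq hq AE BE (fun x => DFunLike.congr_fun hE x)
    AF BF (fun x => DFunLike.congr_fun hF x)
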